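/- arXiv:1512.07285 — 2 statements merged into one kernel-verified Lean document; each statement's English description precedes it below -/
import Mathlib

section
/- Let F be an imaginary quadratic extension of ℚ (a number field of degree 2 over ℚ admitting no real embedding). Then there exists a quaternion division algebra D over ℚ — that is, a division ring D that is a ℚ-algebra of dimension 4 whose center is exactly ℚ — such that D splits over ℝ and over F: D ⊗_ℚ ℝ is isomorphic as an ℝ-algebra to the algebra of 2×2 real matrices, and D ⊗_ℚ F is isomorphic as an F-algebra to the algebra of 2×2 matrices over F. -/
open scoped TensorProduct Quaternion

/-- A natural number congruent to `3` modulo `4` has a prime factor congruent to `3` modulo `4`. -/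
theorem Nat.exists_prime_mod_four_eq_three_dvd (n : ℕ) (hn : n % 4 = 3) :
    ∃ p, p.Prime ∧ p % 4 = 3 ∧ p ∣ n := by
  induction n using Nat.recOnMul with
  | zero => omega
  | one => omega
  | prime p hp => exact ⟨p, hp, hn, dvd_rfl⟩
  | mul a b iha ihb =>
    have h : a % 4 = 3 ∨ b % 4 = 3 := by
      rw [Nat.mul_mod] at hn
      have ha := Nat.mod_lt a (show 0 < 4 by norm_num)
      have hb := Nat.mod_lt b (show 0 < 4 by norm_num)
      generalize a % 4 = r at *
      generalize b % 4 = s at *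
      interval_cases r <;> interval_cases s <;> simp_all
    rcases h with h | h
    · obtain ⟨p, hp, hp3, hpd⟩ := iha h
      exact ⟨p, hp, hp3, hpd.mul_right b⟩
    · obtain ⟨p, hp, hp3, hpd⟩ := ihb h
      exact ⟨p, hp, hp3, hpd.mul_left a⟩

theorem Int.dvd_and_dvd_of_dvd_sq_add_mul_sq {m p : ℕ} (hp : p.Prime) (hp3 : p % 4 = 3)
    (hpm : (p : ℤ) ∣ 4 * m - 1) {x y : ℤ} (h : (p : ℤ) ∣ x ^ 2 + m * y ^ 2) :
    (p : ℤ) ∣ x ∧ (p : ℤ) ∣ y := by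
  have := Fact.mk hp
  have key : (p : ℤ) ∣ (2 * x) ^ 2 + y ^ 2 := by
    have e : (2 * x) ^ 2 + y ^ 2 = 4 * (x ^ 2 + m * y ^ 2) - (4 * m - 1) * y ^ 2 := by ring
    rw [e]
    exact dvd_sub (h.mul_left 4) (hpm.mul_right (y ^ 2))
  have hy : (p : ℤ) ∣ y := by
    rw [← ZMod.intCast_zmod_eq_zero_iff_dvd]
    by_contra hy
    refine ZMod.mod_four_ne_three_of_sq_eq_neg_sq' (x := ((2 * x : ℤ) : ZMod p)) hy ?_ hp3
    rw [← ZMod.intCast_zmod_eq_zero_iff_dvd] at key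
    push_cast at key ⊢
    linear_combination key
  refine ⟨?_, hy⟩
  have hx : (p : ℤ) ∣ x ^ 2 :=
    (dvd_add_left (Dvd.dvd.mul_left (dvd_pow hy two_ne_zero) _)).mp h
  exact (Nat.prime_iff_prime_int.mp hp).dvd_of_dvd_pow hx

theorem Int.pow_dvd_of_sq_add_mul_sq_eq_mul_sq {m p : ℕ} (hp : p.Prime) (hp3 : p % 4 = 3)
    (hpm : (p : ℤ) ∣ 4 * m - 1) (n : ℕ) :
    ∀ {x y z : ℤ}, x ^ 2 + m * y ^ 2 = p * z ^ 2 → (p : ℤ) ^ n ∣ z := by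
  have hp0 : (p : ℤ) ≠ 0 := by exact_mod_cast hp.ne_zero
  induction n with
  | zero => simp
  | succ n ih =>
    intro x y z h
    obtain ⟨⟨x, rfl⟩, ⟨y, rfl⟩⟩ :=
      Int.dvd_and_dvd_of_dvd_sq_add_mul_sq hp hp3 hpm (Dvd.intro _ h.symm)
    have hz : (p : ℤ) ∣ z := by
      refine (Nat.prime_iff_prime_int.mp hp).dvd_of_dvd_pow (n := 2) ⟨x ^ 2 + m * y ^ 2, ?_⟩
      apply mul_left_cancel₀ hp0
      linear_combination -h
    obtain ⟨z, rfl⟩ := hz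
    rw [pow_succ']
    refine mul_dvd_mul_left _ (ih (x := x) (y := y) ?_)
    apply mul_left_cancel₀ (pow_ne_zero 2 hp0)
    linear_combination h

theorem Int.eq_zero_of_sq_add_mul_sq_eq_mul_sq {m p : ℕ} (hp : p.Prime) (hp3 : p % 4 = 3)
    (hpm : (p : ℤ) ∣ 4 * m - 1) {x y z : ℤ}
    (h : x ^ 2 + m * y ^ 2 = p * z ^ 2) : z = 0 := by
  refine Int.eq_zero_of_dvd_of_natAbs_lt_natAbs
    (Int.pow_dvd_of_sq_add_mul_sq_eq_mul_sq hp hp3 hpm z.natAbs h) ?_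
  rw [Int.natAbs_pow, Int.natAbs_natCast]
  exact Nat.lt_pow_self hp.one_lt

theorem Rat.eq_zero_of_sq_add_mul_sq_eq_mul_sq {m p : ℕ} (hp : p.Prime) (hp3 : p % 4 = 3)
    (hpm : (p : ℤ) ∣ 4 * m - 1) {x y z : ℚ}
    (h : x ^ 2 + m * y ^ 2 = p * z ^ 2) : z = 0 := by
  have key : z.num * x.den * y.den = 0 := by
    apply Int.eq_zero_of_sq_add_mul_sq_eq_mul_sq hp hp3 hpm
      (x := x.num * y.den * z.den) (y := y.num * x.den * z.den)
    have hx := x.mul_den_eq_num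
    have hy := y.mul_den_eq_num
    have hz := z.mul_den_eq_num
    have : ((x.num * y.den * z.den : ℚ)) ^ 2 + m * (y.num * x.den * z.den) ^ 2
        = p * (z.num * x.den * y.den) ^ 2 := by
      rw [← hx, ← hy, ← hz]
      linear_combination ((x.den : ℚ) * y.den * z.den) ^ 2 * h
    exact_mod_cast this
  simpa using key

/-- The norm form of the quaternion algebra `(-m, p)` over `ℚ` is anisotropic. -/
theorem QuaternionAlgebra.eq_zero_of_norm_eq_zero {m p : ℕ} (hp : p.Prime) (hp3 : p % 4 = 3)
    (hpm : (p : ℤ) ∣ 4 * m - 1) (hm : 0 < m)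
    {a b c d : ℚ} (h : a ^ 2 + m * b ^ 2 = p * (c ^ 2 + m * d ^ 2)) :
    a = 0 ∧ b = 0 ∧ c = 0 ∧ d = 0 := by
  have hm' : (0 : ℚ) < m := by exact_mod_cast hm
  have anis {u v : ℚ} (huv : u ^ 2 + m * v ^ 2 = 0) : u = 0 ∧ v = 0 := by
    have hv : v ^ 2 = 0 := by nlinarith [sq_nonneg u, sq_nonneg v]
    have hu : u ^ 2 = 0 := by rw [hv] at huv; linarith
    exact ⟨pow_eq_zero_iff two_ne_zero |>.mp hu, pow_eq_zero_iff two_ne_zero |>.mp hv⟩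
  have hcd : c ^ 2 + m * d ^ 2 = 0 := by
    apply Rat.eq_zero_of_sq_add_mul_sq_eq_mul_sq hp hp3 hpm
      (x := a * c + m * b * d) (y := a * d - b * c)
    linear_combination (c ^ 2 + m * d ^ 2) * h
  obtain ⟨hc, hd⟩ := anis hcd
  rw [hcd, mul_zero] at h
  obtain ⟨ha, hb⟩ := anis h
  exact ⟨ha, hb, hc, hd⟩

theorem QuaternionAlgebra.isUnit_or_eq_zero {m p : ℕ} (hp : p.Prime) (hp3 : p % 4 = 3)
    (hpm : (p : ℤ) ∣ 4 * m - 1) (hm : 0 < m) (q : ℍ[ℚ,-(m : ℚ),0,(p : ℚ)]) :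
    IsUnit q ∨ q = 0 := by
  by_cases h : (q * star q).re = 0
  · right
    have := QuaternionAlgebra.eq_zero_of_norm_eq_zero hp hp3 hpm hm
      (a := q.re) (b := q.imI) (c := q.imJ) (d := q.imK) (by
        simp at h
        linear_combination h)
    ext <;> simp [this]
  · left
    have hN : IsUnit (q * star q) := by
      rw [QuaternionAlgebra.mul_star_eq_coe]
      exact (IsUnit.mk0 _ h).map (algebraMap ℚ ℍ[ℚ,-(m : ℚ),0,(p : ℚ)])
    have hc : Commute q (star q) := by
      ext <;> simp <;> ring
    exact (hc.isUnit_mul_iff.mp hN).1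

theorem QuaternionAlgebra.center_eq_bot {a c : ℚ} (ha : a ≠ 0) :
    Subalgebra.center ℚ ℍ[ℚ,a,0,c] = ⊥ := by
  rw [eq_bot_iff]
  intro q hq
  rw [Subalgebra.mem_center_iff] at hq
  have hi := hq ⟨0, 1, 0, 0⟩
  have hj := hq ⟨0, 0, 1, 0⟩
  simp only [QuaternionAlgebra.ext_iff, QuaternionAlgebra.re_mul, QuaternionAlgebra.imI_mul,
    QuaternionAlgebra.imJ_mul, QuaternionAlgebra.imK_mul] at hi hj
  have hJ : q.imJ = 0 := by linarith [hi.2.2.2]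
  have hI : q.imI = 0 := by linarith [hj.2.2.2]
  have hK : q.imK = 0 := by
    have : a * q.imK = 0 := by linarith [hi.2.2.1]
    exact (mul_eq_zero.mp this).resolve_left ha
  rw [Algebra.mem_bot]
  refine ⟨q.re, ?_⟩
  ext <;> simp [QuaternionAlgebra.algebraMap_eq, hI, hJ, hK]

section Split

variable {K : Type*} [Field K] [Algebra ℚ K] {a c : ℚ} (α : K)

/-- The standard generators of `2 × 2` matrices satisfying the quaternion relations, given a
square root of the first parameter. -/
def QuaternionAlgebra.matrixBasis (c : ℚ) (hα : α ^ 2 = algebraMap ℚ K a) :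
    QuaternionAlgebra.Basis (Matrix (Fin 2) (Fin 2) K) a 0 c where
  i := !![α, 0; 0, -α]
  j := !![0, algebraMap ℚ K c; 1, 0]
  k := !![0, α * algebraMap ℚ K c; -α, 0]
  i_mul_i := by
    ext i j
    fin_cases i <;> fin_cases j <;> simp [Algebra.smul_def, Matrix.algebraMap_matrix_apply, ← hα, sq]
  j_mul_j := by
    ext i j
    fin_cases i <;> fin_cases j <;> simp [Algebra.smul_def]
  i_mul_j := by
    ext i j
    fin_cases i <;> fin_cases j <;> simp
  j_mul_i := by
    ext i j
    fin_cases i <;> fin_cases j <;> simp [mul_comm]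

theorem QuaternionAlgebra.nonempty_tensor_algEquiv_matrix (hα : α ^ 2 = algebraMap ℚ K a)
    (ha : a ≠ 0) (hc : c ≠ 0) :
    Nonempty ((K ⊗[ℚ] ℍ[ℚ,a,0,c]) ≃ₐ[K] Matrix (Fin 2) (Fin 2) K) := by
  have : CharZero K := algebraRat.charZero K
  let B := QuaternionAlgebra.matrixBasis α c hα
  let f : (K ⊗[ℚ] ℍ[ℚ,a,0,c]) →ₐ[K] Matrix (Fin 2) (Fin 2) K :=
    Algebra.TensorProduct.lift (Algebra.ofId K _) B.liftHom
      fun x y => Algebra.commutes x (B.liftHom y)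
  have hα0 : α ≠ 0 := by
    rintro rfl
    apply ha
    simpa using hα.symm
  have hc0 : algebraMap ℚ K c ≠ 0 := by simpa using hc
  have hsurj : Function.Surjective f := by
    intro M
    refine ⟨((M 0 0 + M 1 1) / 2) ⊗ₜ 1 + ((M 0 0 - M 1 1) / (2 * α)) ⊗ₜ ⟨0, 1, 0, 0⟩
      + ((M 0 1 / algebraMap ℚ K c + M 1 0) / 2) ⊗ₜ ⟨0, 0, 1, 0⟩
      + ((M 0 1 / algebraMap ℚ K c - M 1 0) / (2 * α)) ⊗ₜ ⟨0, 0, 0, 1⟩, ?_⟩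
    ext i j
    fin_cases i <;> fin_cases j <;>
      simp [f, B, QuaternionAlgebra.matrixBasis, QuaternionAlgebra.Basis.lift,
        Algebra.ofId_apply, Matrix.algebraMap_eq_diagonal] <;> field_simp <;> ring
  have hdim : Module.finrank K (K ⊗[ℚ] ℍ[ℚ,a,0,c]) =
      Module.finrank K (Matrix (Fin 2) (Fin 2) K) := by
    rw [Module.finrank_baseChange, QuaternionAlgebra.finrank_eq_four, Module.finrank_matrix]
    simp
  have hinj : Function.Injective f :=
    (LinearMap.injective_iff_surjective_of_finrank_eq_finrank (f := f.toLinearMap) hdim).mpr hsurj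
  exact ⟨AlgEquiv.ofBijective f ⟨hinj, hsurj⟩⟩

end Split

theorem Polynomial.Monic.aeval_eq_of_natDegree_eq_two {R A : Type*} [CommRing R] [CommRing A]
    [Algebra R A] {f : Polynomial R} (hf : f.Monic) (hdeg : f.natDegree = 2) (y : A) :
    Polynomial.aeval y f =
      algebraMap R A (f.coeff 0) + algebraMap R A (f.coeff 1) * y + y ^ 2 := by
  have h2 : f.coeff 2 = 1 := hdeg ▸ hf.coeff_natDegree
  rw [Polynomial.aeval_eq_sum_range, hdeg]
  simp [Finset.sum_range_succ, Algebra.smul_def, h2]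

/-- An imaginary quadratic field contains a square root of a negative integer. -/
theorem exists_sq_eq_neg_natCast_of_isEmpty_ringHom_real
    (F : Type*) [Field F] [NumberField F]
    (hdeg : Module.finrank ℚ F = 2) (himag : IsEmpty (F →+* ℝ)) :
    ∃ (m : ℕ) (α : F), 0 < m ∧ α ^ 2 = -(m : F) := by
  let pb := Field.powerBasisOfFiniteOfSeparable ℚ F
  have hmonic := minpoly.monic pb.isIntegral_gen
  have hnat : (minpoly ℚ pb.gen).natDegree = 2 := by
    rw [pb.natDegree_minpoly, ← pb.finrank, hdeg]
  set b := (minpoly ℚ pb.gen).coeff 1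
  set c := (minpoly ℚ pb.gen).coeff 0
  have hdisc : b ^ 2 - 4 * c < 0 := by
    by_contra! h
    have h' : (0 : ℝ) ≤ (b : ℝ) ^ 2 - 4 * c := by exact_mod_cast h
    refine himag.false
      (pb.lift ((-(b : ℝ) + √((b : ℝ) ^ 2 - 4 * c)) / 2) ?_ : F →ₐ[ℚ] ℝ).toRingHom
    rw [hmonic.aeval_eq_of_natDegree_eq_two hnat]
    simp only [eq_ratCast]
    linear_combination Real.sq_sqrt h' / 4
  have hgen : (2 * pb.gen + (b : F)) ^ 2 = ((b ^ 2 - 4 * c : ℚ) : F) := by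
    have := minpoly.aeval ℚ pb.gen
    rw [hmonic.aeval_eq_of_natDegree_eq_two hnat] at this
    simp only [eq_ratCast] at this
    push_cast
    linear_combination 4 * this
  generalize b ^ 2 - 4 * c = e at hdisc hgen
  have hnum : e.num < 0 := Rat.num_neg.mpr hdisc
  refine ⟨e.num.natAbs * e.den, (2 * pb.gen + (b : F)) * e.den,
    Nat.mul_pos (Int.natAbs_pos.mpr hnum.ne) e.den_pos, ?_⟩
  have hed : (e : F) * (e.den : F) = (e.num : F) := by exact_mod_cast e.mul_den_eq_num
  have habs : ((e.num.natAbs : ℕ) : F) = -(e.num : F) := by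
    rw [← Int.cast_natCast, Int.ofNat_natAbs_of_nonpos hnum.le, Int.cast_neg]
  push_cast
  rw [mul_pow, hgen, habs]
  linear_combination (e.den : F) * hed

/-- For any imaginary quadratic field `F`, there is a quaternion division algebra over `ℚ`
that splits over both `ℝ` and `F`. -/
theorem exists_quaternion_division_algebra_split_at_R_and_F
    (F : Type*) [Field F] [NumberField F]
    (hdeg : Module.finrank ℚ F = 2) (himag : IsEmpty (F →+* ℝ)) :
    ∃ (D : Type) (_ : DivisionRing D) (_ : Algebra ℚ D),
      Module.finrank ℚ D = 4 ∧
      Subalgebra.center ℚ D = ⊥ ∧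
      Nonempty ((ℝ ⊗[ℚ] D) ≃ₐ[ℝ] Matrix (Fin 2) (Fin 2) ℝ) ∧
      Nonempty ((F ⊗[ℚ] D) ≃ₐ[F] Matrix (Fin 2) (Fin 2) F) := by
  obtain ⟨m, α, hm, hα⟩ := exists_sq_eq_neg_natCast_of_isEmpty_ringHom_real F hdeg himag
  obtain ⟨p, hp, hp3, hpm⟩ := Nat.exists_prime_mod_four_eq_three_dvd (4 * m - 1) (by omega)
  have hpm' : (p : ℤ) ∣ 4 * m - 1 := by
    have := Int.natCast_dvd_natCast.mpr hpm
    rwa [Nat.cast_sub (by omega), Nat.cast_mul, Nat.cast_ofNat, Nat.cast_one] at this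
  have hm0 : -(m : ℚ) ≠ 0 := neg_ne_zero.mpr (by exact_mod_cast hm.ne')
  have hp0 : (p : ℚ) ≠ 0 := by exact_mod_cast hp.ne_zero
  refine ⟨ℍ[ℚ,-(m : ℚ),0,(p : ℚ)],
    DivisionRing.ofIsUnitOrEqZero (QuaternionAlgebra.isUnit_or_eq_zero hp hp3 hpm' hm),
    inferInstanceAs (Algebra ℚ ℍ[ℚ,-(m : ℚ),0,(p : ℚ)]),
    QuaternionAlgebra.finrank_eq_four _ _ _, QuaternionAlgebra.center_eq_bot hm0, ?_, ?_⟩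
  · obtain ⟨e⟩ := QuaternionAlgebra.nonempty_tensor_algEquiv_matrix (K := ℝ) (√(p : ℝ))
      (a := p) (c := -m) (by simp) hp0 hm0
    exact ⟨(Algebra.TensorProduct.congr AlgEquiv.refl
      (QuaternionAlgebra.swapEquiv _ _)).trans e⟩
  · exact QuaternionAlgebra.nonempty_tensor_algEquiv_matrix α (by simpa using hα) hm0 hp0
end

section
/- Let F be an imaginary quadratic extension of ℚ (a number field of degree 2 over ℚ admitting no real embedding), and let n ≥ 2. Then there exists a central division algebra D over ℚ of degree 2n (i.e. a division ring that is a ℚ-algebra of dimension (2n)² whose center equals ℚ) such that D splits over ℝ — that is, D ⊗_ℚ ℝ is isomorphic as an ℝ-algebra to the algebra of 2n×2n real matrices — and D ⊗_ℚ F is not a division ring. -/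
open scoped TensorProduct

universe u

/-- `f` and `y` satisfy the defining relations of the cyclic algebra `(L, τ, a)`. -/
structure IsCyclicPair {k L B : Type*} [Field k] [Field L] [Algebra k L] [Ring B] [Algebra k B]
    (τ : L ≃ₐ[k] L) (M : ℕ) (a : k) (f : L →ₐ[k] B) (y : B) : Prop where
  comm : ∀ l, y * f l = f (τ l) * y
  pow_eq : y ^ M = algebraMap k B a
  pow_aut : τ ^ M = 1

namespace IsCyclicPair

variable {k L B B' : Type*} [Field k] [Field L] [Algebra k L] [Ring B] [Algebra k B]
  [Ring B'] [Algebra k B'] {τ : L ≃ₐ[k] L} {M : ℕ} {a : k} {f : L →ₐ[k] B} {y : B}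
  {f' : L →ₐ[k] B'} {y' : B'}

/-- The `k`-linear map `c ↦ ∑ f (c i) y ^ i`. -/
def sumMap (f : L →ₐ[k] B) (y : B) (M : ℕ) : (Fin M → L) →ₗ[k] B where
  toFun c := ∑ i, f (c i) * y ^ (i : ℕ)
  map_add' c d := by simp [add_mul, Finset.sum_add_distrib]
  map_smul' r c := by simp [Finset.smul_sum]

lemma sumMap_apply (c : Fin M → L) : sumMap f y M c = ∑ i, f (c i) * y ^ (i : ℕ) := rfl

lemma sumMap_single (i : Fin M) (l : L) : sumMap f y M (Pi.single i l) = f l * y ^ (i : ℕ) := by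
  rw [sumMap_apply, Finset.sum_eq_single i]
  · simp
  · intro j _ hj; simp [Pi.single_eq_of_ne hj]
  · simp

lemma pow_mul_map (h : IsCyclicPair τ M a f y) (m : ℕ) (l : L) :
    y ^ m * f l = f ((τ ^ m) l) * y ^ m := by
  induction m generalizing l with
  | zero => simp
  | succ m ih =>
    rw [pow_succ, mul_assoc, h.comm, ← mul_assoc, ih, mul_assoc, pow_succ, AlgEquiv.mul_apply]

lemma pow_eq_mod (h : IsCyclicPair τ M a f y) (m : ℕ) :
    y ^ m = f (algebraMap k L (a ^ (m / M))) * y ^ (m % M) := by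
  conv_lhs => rw [← Nat.div_add_mod m M, pow_add, pow_mul, h.pow_eq]
  simp

lemma monomial_mul (h : IsCyclicPair τ M a f y) (l l' : L) (i j : ℕ) :
    (f l * y ^ i) * (f l' * y ^ j) =
      f (l * (τ ^ i) l' * algebraMap k L (a ^ ((i + j) / M))) * y ^ ((i + j) % M) := by
  rw [mul_assoc, ← mul_assoc (y ^ i), h.pow_mul_map, mul_assoc, ← pow_add, h.pow_eq_mod]
  simp only [map_mul, mul_assoc]

/-- The subalgebra generated by a cyclic pair. -/
def subalgebra (h : IsCyclicPair τ M a f y) (hM : 0 < M) : Subalgebra k B :=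
  Submodule.toSubalgebra (LinearMap.range (sumMap f y M))
    ⟨Pi.single ⟨0, hM⟩ 1, by rw [sumMap_single]; simp⟩ (by
      rintro _ _ ⟨c, rfl⟩ ⟨d, rfl⟩
      simp only [sumMap_apply, Finset.sum_mul, Finset.mul_sum]
      refine Submodule.sum_mem _ fun i _ => Submodule.sum_mem _ fun j _ => ?_
      rw [h.monomial_mul]
      exact ⟨Pi.single ⟨_, Nat.mod_lt _ hM⟩ _, sumMap_single _ _⟩)

lemma finrank_subalgebra [FiniteDimensional k L] (h : IsCyclicPair τ M a f y) (hM : 0 < M)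
    (hinj : Function.Injective (sumMap f y M)) :
    Module.finrank k (h.subalgebra hM) = M * Module.finrank k L := by
  have e := LinearEquiv.ofInjective _ hinj
  have : Module.finrank k (h.subalgebra hM) = Module.finrank k (LinearMap.range (sumMap f y M)) :=
    rfl
  rw [this, ← e.finrank_eq]
  simp [Module.finrank_pi_fintype]

lemma exists_algHom (h : IsCyclicPair τ M a f y) (hM : 0 < M)
    (hinj : Function.Injective (sumMap f y M)) (h' : IsCyclicPair τ M a f' y') :
    Nonempty (h.subalgebra hM →ₐ[k] B') := by
  let e : (Fin M → L) ≃ₗ[k] h.subalgebra hM := LinearEquiv.ofInjective _ hinj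
  have he : ∀ c, ((e c : h.subalgebra hM) : B) = sumMap f y M c := fun c => rfl
  let g : h.subalgebra hM →ₗ[k] B' := sumMap f' y' M ∘ₗ e.symm.toLinearMap
  have hg : ∀ c, g (e c) = sumMap f' y' M c := fun c => by simp [g]
  refine ⟨AlgHom.ofLinearMap g ?_ ?_⟩
  · have h1 : (1 : h.subalgebra hM) = e (Pi.single ⟨0, hM⟩ 1) := by
      ext; rw [he, sumMap_single]; simp
    rw [h1, hg, sumMap_single]; simp
  · have key : ∀ c d, e c * e d = e (∑ i : Fin M, ∑ j : Fin M,
        Pi.single ⟨_, Nat.mod_lt ((i : ℕ) + j) hM⟩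
        (c i * (τ ^ (i : ℕ)) (d j) * algebraMap k L (a ^ (((i : ℕ) + j) / M)))) := by
      intro c d
      ext
      rw [Subalgebra.coe_mul, he, he, he]
      simp only [map_sum, sumMap_single]
      simp only [sumMap_apply, Finset.sum_mul, Finset.mul_sum]
      rw [Finset.sum_comm]
      refine Finset.sum_congr rfl fun i _ => Finset.sum_congr rfl fun j _ => ?_
      rw [h.monomial_mul]
    intro x z
    obtain ⟨c, rfl⟩ := e.surjective x
    obtain ⟨d, rfl⟩ := e.surjective z
    rw [key, hg, hg, hg]
    simp only [map_sum, sumMap_single]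
    simp only [sumMap_apply, Finset.sum_mul, Finset.mul_sum]
    rw [Finset.sum_comm]
    refine Finset.sum_congr rfl fun i _ => Finset.sum_congr rfl fun j _ => ?_
    rw [h'.monomial_mul]

end IsCyclicPair

namespace IsCyclicPair

variable {k L B : Type*} [Field k] [Field L] [Algebra k L] [Ring B] [Algebra k B]
  {τ : L ≃ₐ[k] L} {M : ℕ} {a : k} {f : L →ₐ[k] B} {y : B}

open WithZero in
/-- The weight of the monomial `f l * y ^ i` when `a` is a uniformizer for `v`. -/
noncomputable def weight (v : Valuation L (WithZero (Multiplicative ℤ))) (M : ℕ) (l : L) (i : ℕ) :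
    WithZero (Multiplicative ℤ) := v l ^ M * exp (-(i : ℤ))

variable {v : Valuation L (WithZero (Multiplicative ℤ))}

lemma weight_ne_zero {l : L} (hl : l ≠ 0) (i : ℕ) : weight v M l i ≠ 0 :=
  mul_ne_zero (pow_ne_zero _ (v.ne_zero_iff.2 hl)) WithZero.exp_ne_zero

lemma weight_injective {l l' : L} (hl : l ≠ 0) (hl' : l' ≠ 0) {i j : Fin M}
    (h : weight v M l i = weight v M l' j) : i = j := by
  have h1 := congrArg WithZero.log h
  have hv := v.ne_zero_iff.2 hl
  have hv' := v.ne_zero_iff.2 hl'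
  rw [weight, weight, WithZero.log_mul (pow_ne_zero _ hv) WithZero.exp_ne_zero,
    WithZero.log_mul (pow_ne_zero _ hv') WithZero.exp_ne_zero, WithZero.log_pow, WithZero.log_pow,
    WithZero.log_exp, WithZero.log_exp] at h1
  simp only [nsmul_eq_mul] at h1
  have h2 : (M : ℤ) ∣ (i : ℤ) - j := ⟨WithZero.log (v l) - WithZero.log (v l'), by linarith⟩
  have hi := i.2
  have hj := j.2
  have h3 := Int.eq_zero_of_abs_lt_dvd h2 (by rw [abs_lt]; omega)
  ext; omega

lemma weight_mul (hτ : ∀ x, v (τ x) = v x) (ha : v (algebraMap k L a) = WithZero.exp (-1))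
    (l l' : L) (i j : ℕ) :
    weight v M (l * (τ ^ i) l' * algebraMap k L (a ^ ((i + j) / M))) ((i + j) % M) =
      weight v M l i * weight v M l' j := by
  have h1 : ∀ (m : ℕ) (x : L), v ((τ ^ m) x) = v x := by
    intro m
    induction m with
    | zero => simp
    | succ m ih => intro x; rw [pow_succ, AlgEquiv.mul_apply, ih, hτ]
  have h2 : WithZero.exp (-1 : ℤ) ^ ((i + j) / M * M) * WithZero.exp (-(((i + j) % M : ℕ) : ℤ)) =
      WithZero.exp (-(i : ℤ)) * WithZero.exp (-(j : ℤ)) := by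
    rw [← WithZero.exp_nsmul, ← WithZero.exp_add, ← WithZero.exp_add]
    congr 1
    have := Nat.div_add_mod' (i + j) M
    rw [nsmul_eq_mul]
    have h3 : (((i + j) / M * M : ℕ) : ℤ) + (((i + j) % M : ℕ) : ℤ) = i + j := by
      exact_mod_cast this
    linarith
  simp only [weight, map_mul, map_pow, h1, ha, mul_pow, ← pow_mul]
  calc _ = v l ^ M * v l' ^ M * (WithZero.exp (-1 : ℤ) ^ ((i + j) / M * M) *
        WithZero.exp (-(((i + j) % M : ℕ) : ℤ))) := by simp only [mul_assoc]
    _ = _ := by rw [h2, mul_mul_mul_comm]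

lemma weight_add_lt {l l' : L} {i : ℕ} {γ : WithZero (Multiplicative ℤ)}
    (h : weight v M l i < γ) (h' : weight v M l' i < γ) : weight v M (l + l') i < γ := by
  rcases le_max_iff.1 (v.map_add l l') with h1 | h1
  · refine lt_of_le_of_lt ?_ h
    unfold weight; gcongr
  · refine lt_of_le_of_lt ?_ h'
    unfold weight; gcongr

lemma exists_sum_of_weight_lt {ι : Type*} (hM : 0 < M) {γ : WithZero (Multiplicative ℤ)}
    (hγ : γ ≠ 0) (s : Finset ι) (l : ι → L) (m : ι → Fin M)
    (hs : ∀ t ∈ s, weight v M (l t) (m t) < γ) :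
    ∃ c : Fin M → L, sumMap f y M c = ∑ t ∈ s, f (l t) * y ^ (m t : ℕ) ∧
      ∀ i, weight v M (c i) i < γ := by
  classical
  induction s using Finset.induction_on with
  | empty =>
    refine ⟨0, by simp, fun i => ?_⟩
    simpa [weight, hM.ne'] using zero_lt_iff.2 hγ
  | insert t s ht ih =>
    obtain ⟨c, hc, hc'⟩ := ih fun t ht => hs t (Finset.mem_insert_of_mem ht)
    refine ⟨Pi.single (m t) (l t) + c, ?_, fun i => ?_⟩
    · rw [map_add, sumMap_single, hc, Finset.sum_insert ht]
    · refine weight_add_lt ?_ (hc' i)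
      by_cases hi : i = m t
      · subst hi; simpa using hs t (Finset.mem_insert_self _ _)
      · simpa [Pi.single_eq_of_ne hi, weight, hM.ne'] using zero_lt_iff.2 hγ

lemma exists_leading {c : Fin M → L} (hc : c ≠ 0) :
    ∃ i, c i ≠ 0 ∧ ∀ j ≠ i, weight v M (c j) j < weight v M (c i) i := by
  obtain ⟨i₁, hi₁⟩ := Function.ne_iff.1 hc
  have hM : 0 < M := i₁.pos
  obtain ⟨i, -, hi⟩ := Finset.exists_max_image Finset.univ (fun i : Fin M => weight v M (c i) i)
    ⟨i₁, Finset.mem_univ _⟩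
  have hci : c i ≠ 0 := by
    intro h
    have := hi i₁ (Finset.mem_univ _)
    simp only [h] at this
    refine weight_ne_zero (v := v) (M := M) hi₁ i₁ (le_antisymm (this.trans ?_) zero_le)
    simp [weight, hM.ne']
  refine ⟨i, hci, fun j hj => lt_of_le_of_ne (hi j (Finset.mem_univ _)) fun h => ?_⟩
  have hcj : c j ≠ 0 := by
    intro h0
    refine weight_ne_zero (v := v) (M := M) hci i ?_
    rw [← h, h0]; simp [weight, hM.ne']
  exact hj (weight_injective hcj hci h)

theorem mul_ne_zero_of_valuation (h : IsCyclicPair τ M a f y) (hM : 0 < M)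
    (hinj : Function.Injective (sumMap f y M)) (hτ : ∀ x, v (τ x) = v x)
    (ha : v (algebraMap k L a) = WithZero.exp (-1)) {x z : B} (hx : x ∈ h.subalgebra hM)
    (hz : z ∈ h.subalgebra hM) (hx0 : x ≠ 0) (hz0 : z ≠ 0) : x * z ≠ 0 := by
  classical
  obtain ⟨c, rfl⟩ := hx
  obtain ⟨d, rfl⟩ := hz
  obtain ⟨i, hi, hi'⟩ := exists_leading (v := v) (c := c) (by rintro rfl; simp at hx0)
  obtain ⟨j, hj, hj'⟩ := exists_leading (v := v) (c := d) (by rintro rfl; simp at hz0)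
  have hwi := weight_ne_zero (v := v) (M := M) hi i
  have hwj := weight_ne_zero (v := v) (M := M) hj j
  let l : Fin M × Fin M → L := fun t =>
    c t.1 * (τ ^ (t.1 : ℕ)) (d t.2) * algebraMap k L (a ^ (((t.1 : ℕ) + t.2) / M))
  let m : Fin M × Fin M → Fin M := fun t => ⟨((t.1 : ℕ) + t.2) % M, Nat.mod_lt _ hM⟩
  have hw : ∀ t, weight v M (l t) (m t) = weight v M (c t.1) t.1 * weight v M (d t.2) t.2 :=
    fun t => weight_mul hτ ha _ _ _ _
  have hprod : sumMap f y M c * sumMap f y M d =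
      ∑ t : Fin M × Fin M, f (l t) * y ^ (m t : ℕ) := by
    rw [sumMap_apply, sumMap_apply, Finset.sum_mul_sum, ← Finset.sum_product']
    exact Finset.sum_congr rfl fun t _ => h.monomial_mul _ _ _ _
  obtain ⟨e, he, he'⟩ := exists_sum_of_weight_lt (v := v) (f := f) (y := y) hM (mul_ne_zero hwi hwj)
    (Finset.univ.erase (i, j)) l m (by
      rintro ⟨i', j'⟩ ht
      rw [hw]
      have hne : ¬ (i' = i ∧ j' = j) := by simpa using ht
      by_cases h1 : i' = i
      · have h2 : j' ≠ j := fun h2 => hne ⟨h1, h2⟩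
        subst h1
        exact mul_lt_mul_of_pos_left (hj' _ h2) (zero_lt_iff.2 hwi)
      · by_cases h2 : j' = j
        · subst h2
          exact mul_lt_mul_of_pos_right (hi' _ h1) (zero_lt_iff.2 hwj)
        · exact mul_lt_mul'' (hi' _ h1) (hj' _ h2) zero_le zero_le)
  rw [hprod, ← Finset.add_sum_erase _ _ (Finset.mem_univ (i, j)), ← he]
  intro h0
  rw [← sumMap_single, ← map_add] at h0
  have h1 := congrFun ((injective_iff_map_eq_zero _).1 hinj _ h0) (m (i, j))
  simp only [Pi.add_apply, Pi.single_eq_same, Pi.zero_apply] at h1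
  have h2 := he' (m (i, j))
  rw [← hw (i, j), eq_neg_of_add_eq_zero_right h1] at h2
  simp [weight, Valuation.map_neg] at h2

end IsCyclicPair

namespace IsCyclicPair

variable {k L R : Type*} [Field k] [Field L] [Algebra k L] [CommRing R] [Algebra k R]
  {τ : L ≃ₐ[k] L} {M : ℕ} {a : k}

/-- The cyclic shift matrix whose `M`-th power is `a`. -/
def shiftMatrix (M : ℕ) (a : R) : Matrix (Fin M) (Fin M) R :=
  Matrix.of fun i j => if (i : ℕ) + 1 = j then 1 else if (i : ℕ) + 1 = j + M then a else 0

/-- The diagonal representation `l ↦ diag (ρ (τ ^ i l))`. -/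
def diagHom (τ : L ≃ₐ[k] L) (M : ℕ) (ρ : L →ₐ[k] R) : L →ₐ[k] Matrix (Fin M) (Fin M) R :=
  (Matrix.diagonalAlgHom k).comp 
    (AlgHom.pi fun i : Fin M => ρ.comp (τ ^ (i : ℕ) : L ≃ₐ[k] L))

lemma diagHom_apply (ρ : L →ₐ[k] R) (l : L) :
    diagHom τ M ρ l = Matrix.diagonal fun i : Fin M => ρ ((τ ^ (i : ℕ)) l) := rfl

lemma shiftMatrix_mul_apply (a : R) (B : Matrix (Fin M) (Fin M) R) (i j : Fin M) :
    (shiftMatrix M a * B) i j =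
      if h : (i : ℕ) + 1 < M then B ⟨i + 1, h⟩ j else a * B ⟨0, i.pos⟩ j := by
  have hi := i.2
  rw [Matrix.mul_apply]
  split_ifs with h
  · rw [Finset.sum_eq_single ⟨i + 1, h⟩]
    · simp [shiftMatrix]
    · intro b _ hb
      have h1 : ¬ (i : ℕ) + 1 = b := fun h' => hb (by ext; simp [h'])
      have h2 : ¬ (i : ℕ) + 1 = b + M := by omega
      simp [shiftMatrix, h1, h2]
    · simp
  · rw [Finset.sum_eq_single ⟨0, i.pos⟩]
    · have h2 : (i : ℕ) + 1 = M := by omega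
      have h3 : M ≠ 0 := by omega
      simp [shiftMatrix, h2, h3]
    · intro b _ hb
      have hb2 := b.2
      have h0 : (b : ℕ) ≠ 0 := fun h' => hb (by ext; simp [h'])
      have h1 : ¬ (i : ℕ) + 1 = b := by omega
      have h2 : ¬ (i : ℕ) + 1 = b + M := by omega
      simp [shiftMatrix, h1, h2]
    · simp

lemma shiftMatrix_pow_apply (a : R) {m : ℕ} (hm : m ≤ M) (i j : Fin M) :
    (shiftMatrix M a ^ m) i j =
      if (i : ℕ) + m = j then 1 else if (i : ℕ) + m = j + M then a else 0 := by
  induction m generalizing i with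
  | zero =>
    have hi := i.2
    have h2 : ¬ (i : ℕ) + 0 = j + M := by omega
    rw [if_neg h2, pow_zero, Matrix.one_apply]
    simp [Fin.ext_iff]
  | succ m ih =>
    have hi := i.2
    have hj := j.2
    rw [pow_succ', shiftMatrix_mul_apply]
    split_ifs <;> first
      | omega
      | (rw [ih (by omega)]; simp only; split_ifs <;> first | omega | simp)

lemma shiftMatrix_pow (a : R) : shiftMatrix M a ^ M = algebraMap R _ a := by
  ext i j
  have hi := i.2
  have hj := j.2
  rw [shiftMatrix_pow_apply a le_rfl, Matrix.algebraMap_matrix_apply]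
  have : ¬ (i : ℕ) + M = j := by omega
  simp [this, Fin.ext_iff]

lemma diagHom_pair (hτ : τ ^ M = 1) (ρ : L →ₐ[k] R) :
    IsCyclicPair τ M a (diagHom τ M ρ) (shiftMatrix M (algebraMap k R a)) where
  comm l := by
    ext i j
    have hi := i.2
    have hj := j.2
    rw [diagHom_apply, diagHom_apply, Matrix.mul_diagonal, Matrix.diagonal_mul]
    have h1 : ∀ m : ℕ, (τ ^ m) (τ l) = (τ ^ (m + 1)) l := fun m => by
      rw [pow_succ, AlgEquiv.mul_apply]
    rw [h1]
    simp only [shiftMatrix, Matrix.of_apply]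
    split_ifs with h h'
    · rw [h, one_mul, mul_one]
    · have hj0 : (j : ℕ) = 0 := by omega
      have : (i : ℕ) + 1 = M := by omega
      rw [this, hτ, hj0]; simp [mul_comm]
    · simp
  pow_eq := by rw [shiftMatrix_pow]; rfl
  pow_aut := hτ

lemma diagHom_injective (hM : 0 < M) (ρ : L →ₐ[k] R) (hρ : Function.Injective ρ) :
    Function.Injective (sumMap (diagHom τ M ρ) (shiftMatrix M (algebraMap k R a)) M) := by
  rw [injective_iff_map_eq_zero]
  intro c hc
  ext j
  have h1 := congrFun (congrFun hc ⟨0, hM⟩) j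
  rw [sumMap_apply, Matrix.sum_apply, Finset.sum_eq_single j] at h1
  · rw [diagHom_apply, Matrix.diagonal_mul, shiftMatrix_pow_apply _ j.2.le] at h1
    simp at h1
    simpa using hρ (h1.trans (map_zero ρ).symm)
  · intro b _ hb
    have hb2 := b.2
    rw [diagHom_apply, Matrix.diagonal_mul, shiftMatrix_pow_apply _ b.2.le]
    have h1 : ¬ 0 + (b : ℕ) = j := fun h => hb (by ext; omega)
    have h2 : ¬ 0 + (b : ℕ) = j + M := by omega
    simp only [h1, h2, if_false, mul_zero]
  · simp

lemma map_mem {B : Type*} [Ring B] [Algebra k B] {f : L →ₐ[k] B} {y : B}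
    (h : IsCyclicPair τ M a f y) (hM : 0 < M) (l : L) : f l ∈ h.subalgebra hM :=
  ⟨Pi.single ⟨0, hM⟩ l, by rw [sumMap_single]; simp⟩

lemma mem_of_one_lt {B : Type*} [Ring B] [Algebra k B] {f : L →ₐ[k] B} {y : B}
    (h : IsCyclicPair τ M a f y) (hM : 1 < M) : y ∈ h.subalgebra (by omega) :=
  ⟨Pi.single ⟨1, hM⟩ 1, by rw [sumMap_single]; simp⟩

theorem center_subalgebra {B : Type*} [Ring B] [Algebra k B] {f : L →ₐ[k] B} {y : B}
    (h : IsCyclicPair τ M a f y) (hM : 1 < M) (hinj : Function.Injective (sumMap f y M))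
    (hτ : ∀ i, 0 < i → i < M → τ ^ i ≠ 1) (hfix : ∀ l, τ l = l → l ∈ Set.range (algebraMap k L)) :
    Subalgebra.center k (h.subalgebra (by omega : 0 < M)) = ⊥ := by
  have hM0 : 0 < M := by omega
  rw [eq_bot_iff]
  rintro ⟨x, hx⟩ hc
  rw [Subalgebra.mem_center_iff] at hc
  obtain ⟨c, rfl⟩ := hx
  have h1 : ∀ l, f l * sumMap f y M c = sumMap f y M c * f l := fun l =>
    congrArg Subtype.val (hc ⟨f l, h.map_mem hM0 l⟩)
  have h2 : y * sumMap f y M c = sumMap f y M c * y :=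
    congrArg Subtype.val (hc ⟨y, h.mem_of_one_lt hM⟩)
  have h3 : ∀ i : Fin M, (i : ℕ) ≠ 0 → c i = 0 := by
    intro i hi
    by_contra hci
    refine hτ i (by omega) i.2 ?_
    ext l
    have e : sumMap f y M (fun j => l * c j) = sumMap f y M (fun j => c j * (τ ^ (j : ℕ)) l) := by
      simp only [sumMap_apply, map_mul, mul_assoc, ← h.pow_mul_map]
      have := h1 l
      simp only [sumMap_apply, Finset.sum_mul, Finset.mul_sum] at this
      simpa only [mul_assoc] using this
    have := congrFun (hinj e) i
    rw [mul_comm] at this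
    simpa using (mul_left_cancel₀ hci this).symm
  have h4 : c = Pi.single ⟨0, hM0⟩ (c ⟨0, hM0⟩) := by
    ext i
    by_cases hi : i = ⟨0, hM0⟩
    · subst hi; simp
    · rw [Pi.single_eq_of_ne hi]
      exact h3 i fun h => hi (by ext; exact h)
  have h5 : sumMap f y M c = f (c ⟨0, hM0⟩) := by
    rw [h4, sumMap_single]; simp
  rw [h5, h.comm] at h2
  have e : sumMap f y M (Pi.single ⟨1, hM⟩ (τ (c ⟨0, hM0⟩))) =
      sumMap f y M (Pi.single ⟨1, hM⟩ (c ⟨0, hM0⟩)) := by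
    simpa [sumMap_single] using h2
  obtain ⟨r, hr⟩ := hfix _ (Pi.single_injective _ (hinj e))
  refine Algebra.mem_bot.2 ⟨r, Subtype.ext ?_⟩
  change algebraMap k B r = sumMap f y M c
  rw [h5, ← hr, AlgHom.commutes]

section Split

variable {K : Type*} [Field K] [Algebra k K]

lemma span_diag_eq_top (ρ : L →ₐ[k] K) (hτ : ∀ i, 0 < i → i < M → τ ^ i ≠ 1) :
    Submodule.span K (Set.range fun l : L => fun i : Fin M => ρ ((τ ^ (i : ℕ)) l)) = ⊤ := by
  classical
  by_contra hne
  obtain ⟨φ, hφ0, hφ⟩ := Submodule.exists_le_ker_of_lt_top _ (lt_top_iff_ne_top.2 hne)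
  have hinj : Function.Injective fun i : Fin M =>
      (((ρ : L →* K).comp ((τ ^ (i : ℕ) : L ≃ₐ[k] L) : L →* L)) : L →* K) := by
    have aux : ∀ i j : Fin M, i < j → (∀ l, ρ ((τ ^ (i : ℕ)) l) = ρ ((τ ^ (j : ℕ)) l)) → False := by
      intro i j hij hl
      refine hτ (j - i) (by omega) (by omega) ?_
      ext l
      have h1 := ρ.injective (hl ((τ ^ (i : ℕ)).symm l))
      have h2 : τ ^ (j : ℕ) = τ ^ (j - i : ℕ) * τ ^ (i : ℕ) := by rw [← pow_add]; congr 1; omega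
      rw [h2, AlgEquiv.mul_apply, AlgEquiv.apply_symm_apply] at h1
      simpa using h1.symm
    intro i j hij
    have hl : ∀ l, ρ ((τ ^ (i : ℕ)) l) = ρ ((τ ^ (j : ℕ)) l) := fun l => DFunLike.congr_fun hij l
    rcases lt_trichotomy i j with h | h | h
    · exact (aux i j h hl).elim
    · exact h
    · exact (aux j i h fun l => (hl l).symm).elim
  have hli := (linearIndependent_monoidHom L K).comp _ hinj
  rw [Fintype.linearIndependent_iff] at hli
  have h0 := hli (fun i => φ (Pi.single i 1)) (by
    ext l
    have h1 : φ (fun i : Fin M => ρ ((τ ^ (i : ℕ)) l)) = 0 :=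
      LinearMap.mem_ker.1 (hφ (Submodule.subset_span ⟨l, rfl⟩))
    rw [LinearMap.pi_apply_eq_sum_univ] at h1
    simp only [Finset.sum_apply, Pi.smul_apply, Function.comp_apply, smul_eq_mul, Pi.zero_apply]
    rw [← h1]
    refine Finset.sum_congr rfl fun i _ => ?_
    have h2 : (fun j => if i = j then (1 : K) else 0) = Pi.single i 1 := by
      ext j; simp [Pi.single_apply, eq_comm]
    rw [smul_eq_mul, mul_comm, h2]
    rfl)
  refine hφ0 (LinearMap.pi_ext' fun i => LinearMap.ext_ring ?_)
  simpa using h0 i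

lemma subalgebra_eq_top (A : Subalgebra K (Matrix (Fin M) (Fin M) K)) {a : K} (ha : a ≠ 0)
    (hs : shiftMatrix M a ∈ A) (hd : ∀ w : Fin M → K, Matrix.diagonal w ∈ A) : A = ⊤ := by
  have key : ∀ i j : Fin M, Matrix.single i j (1 : K) ∈ A := by
    intro i j
    have hi := i.2
    have hj := j.2
    by_cases hij : (i : ℕ) ≤ j
    · have : Matrix.single i j (1 : K) =
          Matrix.diagonal (Pi.single i 1) * shiftMatrix M a ^ (j - i : ℕ) := by
        ext u w
        have hw := w.2
        rw [Matrix.diagonal_mul, shiftMatrix_pow_apply _ (by omega), Matrix.single_apply]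
        by_cases hu : i = u
        · subst hu
          have h1 : ¬ (i : ℕ) + (j - i) = w + M := by omega
          have h2 : ((i : ℕ) + (j - i) = w) ↔ j = w := by rw [Fin.ext_iff]; omega
          simp [h1, h2]
        · simp [hu, Ne.symm hu]
      rw [this]; exact A.mul_mem (hd _) (A.pow_mem hs _)
    · have : Matrix.single i j (1 : K) =
          Matrix.diagonal (Pi.single i a⁻¹) * shiftMatrix M a ^ (j + M - i : ℕ) := by
        ext u w
        have hw := w.2
        rw [Matrix.diagonal_mul, shiftMatrix_pow_apply _ (by omega), Matrix.single_apply]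
        by_cases hu : i = u
        · subst hu
          have h1 : ¬ (i : ℕ) + (j + M - i) = w := by omega
          have h2 : ((i : ℕ) + (j + M - i) = w + M) ↔ j = w := by rw [Fin.ext_iff]; omega
          rw [if_neg h1]
          simp only [h2, Pi.single_eq_same]
          by_cases hjw : j = w <;> simp [hjw, ha]
        · simp [hu, Ne.symm hu]
      rw [this]; exact A.mul_mem (hd _) (A.pow_mem hs _)
  rw [eq_top_iff]
  intro X _
  rw [Matrix.matrix_eq_sum_single X]
  refine A.sum_mem fun i _ => A.sum_mem fun j _ => ?_
  have : Matrix.single i j (X i j) = X i j • Matrix.single i j (1 : K) := by simp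
  rw [this]
  exact A.smul_mem (key i j) _

theorem nonempty_splitting [FiniteDimensional k L] (hrank : Module.finrank k L = M) (hM : 1 < M)
    (ha : a ≠ 0) (hτM : τ ^ M = 1)
    (hτ : ∀ i, 0 < i → i < M → τ ^ i ≠ 1) (ρ : L →ₐ[k] K) :
    Nonempty ((K ⊗[k] ((diagHom_pair (a := a) hτM (AlgHom.id k L)).subalgebra
      (by omega : 0 < M))) ≃ₐ[K] Matrix (Fin M) (Fin M) K) := by
  have hM0 : 0 < M := by omega
  have hpair := diagHom_pair (a := a) hτM (AlgHom.id k L)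
  set D := hpair.subalgebra hM0
  let g : D →ₐ[k] Matrix (Fin M) (Fin M) K := ρ.mapMatrix.comp D.val
  let G : K ⊗[k] D →ₐ[K] Matrix (Fin M) (Fin M) K :=
    Algebra.TensorProduct.lift (Algebra.ofId K _) g fun r x => Algebra.commutes r (g x)
  have hG : ∀ x : D, G (1 ⊗ₜ x) = g x := fun x =>
    (Algebra.TensorProduct.lift_tmul _ _ _ _ _).trans (by simp)
  have hdiag : ∀ l, Matrix.diagonal (fun i : Fin M => ρ ((τ ^ (i : ℕ)) l)) ∈ G.range := by
    intro l
    refine ⟨1 ⊗ₜ ⟨_, hpair.map_mem hM0 l⟩, ?_⟩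
    refine (hG _).trans ?_
    simp [g, diagHom_apply, Matrix.diagonal_map]
  have hsurj : G.range = ⊤ := by
    refine subalgebra_eq_top _ (a := algebraMap k K a) (by simpa using ha) ?_ fun w => ?_
    · refine ⟨1 ⊗ₜ ⟨_, hpair.mem_of_one_lt hM⟩, ?_⟩
      refine (hG _).trans ?_
      ext i j
      simp only [g, shiftMatrix, AlgHom.coe_comp, Function.comp_apply, Subalgebra.coe_val,
        AlgHom.mapMatrix_apply, Matrix.map_apply, Matrix.of_apply]
      split_ifs <;> simp
    · have hw : w ∈ Submodule.span K
          (Set.range fun l : L => fun i : Fin M => ρ ((τ ^ (i : ℕ)) l)) := by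
        rw [span_diag_eq_top ρ hτ]; trivial
      have hle : Submodule.span K (Set.range fun l : L => fun i : Fin M => ρ ((τ ^ (i : ℕ)) l)) ≤
          (Subalgebra.toSubmodule G.range).comap (Matrix.diagonalLinearMap (Fin M) K K) := by
        rw [Submodule.span_le]
        rintro _ ⟨l, rfl⟩
        exact hdiag l
      exact hle hw
  have hsurj' : Function.Surjective G := (AlgHom.range_eq_top G).1 hsurj
  have hfin : Module.finrank k D = M * M := by
    rw [hpair.finrank_subalgebra hM0 (diagHom_injective hM0 _ Function.injective_id), hrank]
  have : Module.Finite k D := Module.finite_of_finrank_pos (by rw [hfin]; positivity)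
  have hrk : Module.finrank K (K ⊗[k] D) = Module.finrank K (Matrix (Fin M) (Fin M) K) := by
    rw [Module.finrank_baseChange, hfin, Module.finrank_matrix]; simp
  have hinj : Function.Injective G :=
    (LinearMap.injective_iff_surjective_of_finrank_eq_finrank (f := G.toLinearMap) hrk).2 hsurj'
  exact ⟨AlgEquiv.ofBijective G ⟨hinj, hsurj'⟩⟩

end Split

end IsCyclicPair

theorem not_forall_isUnit_of_finrank_lt {k F D C V : Type*} [Field k] [Field F] [Algebra k F]
    [Ring D] [Algebra k D] [Ring C] [Algebra k C] [FiniteDimensional k C]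
    [AddCommGroup V] [Module F V] [FiniteDimensional F V] [Module k V] [IsScalarTower k F V]
    [Nontrivial V] (i : C →ₐ[k] D) (hi : Function.Injective i) (g : C →ₐ[k] Module.End F V)
    (hlt : Module.finrank F V < Module.finrank k C) :
    ¬ ∀ x : F ⊗[k] D, x ≠ 0 → IsUnit x := by
  intro hD
  let j : F ⊗[k] C →ₐ[F] F ⊗[k] D := Algebra.TensorProduct.map (AlgHom.id F F) i
  have hj : Function.Injective j :=
    Module.Flat.lTensor_preserves_injective_linearMap (M := F) i.toLinearMap hi
  let G : F ⊗[k] C →ₐ[F] Module.End F V :=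
    Algebra.TensorProduct.lift (Algebra.ofId F _) g fun r x => Algebra.commutes r (g x)
  have hunit : ∀ e : F ⊗[k] C, e ≠ 0 → ∃ x, x * e = 1 := by
    intro e he
    have hje := hD (j e) ((map_ne_zero_iff j hj).2 he)
    have hinj : Function.Injective (LinearMap.mulRight F e) := by
      rw [injective_iff_map_eq_zero]
      intro x hx
      have h1 : j x * j e = 0 := by
        rw [← map_mul]
        exact (congrArg j hx).trans (map_zero j)
      exact (map_eq_zero_iff j hj).1 ((IsUnit.mul_left_eq_zero hje).1 h1)
    obtain ⟨x, hx⟩ := LinearMap.surjective_of_injective hinj 1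
    exact ⟨x, hx⟩
  obtain ⟨w, hw⟩ := exists_ne (0 : V)
  let ev : F ⊗[k] C →ₗ[F] V := (LinearMap.applyₗ w) ∘ₗ G.toLinearMap
  have hev : ∀ e, ev e = G e w := fun e => rfl
  have hinj : Function.Injective ev := by
    rw [injective_iff_map_eq_zero]
    intro e he
    by_contra hne
    obtain ⟨x, hx⟩ := hunit e hne
    apply hw
    have h1 : G (x * e) w = w := by rw [hx, map_one]; rfl
    rw [← h1, map_mul, Module.End.mul_apply, ← hev e, he, map_zero]
  have := LinearMap.finrank_le_finrank_of_injective hinj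
  rw [Module.finrank_baseChange] at this
  omega

namespace IsCyclicPair

variable {k L L₂ B : Type*} [Field k] [Field L] [Algebra k L] [Ring B] [Algebra k B]
  [Field L₂] [Algebra k L₂] {τ : L ≃ₐ[k] L} {M r s : ℕ} {a : k} {f : L →ₐ[k] B} {y : B}

lemma comp_pow (h : IsCyclicPair τ M a f y) (ι : L₂ →ₐ[k] L) (τ₂ : L₂ ≃ₐ[k] L₂) (hM : M = r * s)
    (hτ₂ : τ₂ ^ s = 1) (hι : ∀ x, ι (τ₂ x) = (τ ^ r) (ι x)) :
    IsCyclicPair τ₂ s a (f.comp ι) (y ^ r) where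
  comm l := by rw [AlgHom.comp_apply, AlgHom.comp_apply, h.pow_mul_map, hι]
  pow_eq := by rw [← pow_mul, ← hM, h.pow_eq]
  pow_aut := hτ₂

lemma sumMap_comp_pow (ι : L₂ →ₐ[k] L) (hr : 0 < r) (hM : M = r * s) (c : Fin s → L₂) :
    sumMap (f.comp ι) (y ^ r) s c = sumMap f y M
      (∑ i : Fin s, Pi.single ⟨r * i, by rw [hM]; exact Nat.mul_lt_mul_of_pos_left i.2 hr⟩
        (ι (c i))) := by
  simp only [map_sum, sumMap_single]
  rw [sumMap_apply]
  exact Finset.sum_congr rfl fun i _ => by simp [pow_mul]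

lemma sumMap_comp_pow_injective (hinj : Function.Injective (sumMap f y M)) (ι : L₂ →ₐ[k] L)
    (hr : 0 < r) (hM : M = r * s) : Function.Injective (sumMap (f.comp ι) (y ^ r) s) := by
  classical
  rw [injective_iff_map_eq_zero]
  intro c hc
  rw [sumMap_comp_pow ι hr hM] at hc
  have h0 := (injective_iff_map_eq_zero _).1 hinj _ hc
  ext j
  have h1 := congrFun h0 ⟨r * j, by rw [hM]; exact Nat.mul_lt_mul_of_pos_left j.2 hr⟩
  rw [Finset.sum_apply, Finset.sum_eq_single j] at h1
  · exact ι.injective (by simpa using h1)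
  · intro b _ hb
    refine Pi.single_eq_of_ne (fun h => hb ?_) _
    rw [Fin.mk.injEq] at h
    exact Fin.ext (Nat.eq_of_mul_eq_mul_left hr h).symm
  · simp

end IsCyclicPair

open IsCyclicPair in
/-- The cyclic algebra `(L, σ, a)` over `k` has all the required properties as soon as `a` is a
uniformizer at a `σ`-invariant discrete valuation of `L`, `L` embeds into `K`, and a subalgebra
`(L₂, τ₂, a)` acts on a small `F`-vector space. -/
theorem exists_divisionRing_of_isCyclicPair {k L L₂ : Type} {F K V : Type*}
    [Field k] [Field L] [Algebra k L] [FiniteDimensional k L] [Field L₂] [Algebra k L₂]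
    [FiniteDimensional k L₂] [Field F] [Algebra k F] [Field K] [Algebra k K] [AddCommGroup V]
    [Module F V] [FiniteDimensional F V] [Module k V] [IsScalarTower k F V] [Nontrivial V]
    {N r s : ℕ} (hN : 1 < N) (hrank : Module.finrank k L = N) (hNrs : N = r * s)
    {σ : L ≃ₐ[k] L} (hσ : orderOf σ = N) (hfix : ∀ l, σ l = l → l ∈ Set.range (algebraMap k L))
    (ρ : L →ₐ[k] K) {a : k} {v : Valuation L (WithZero (Multiplicative ℤ))}
    (hv : ∀ x, v (σ x) = v x) (ha : v (algebraMap k L a) = WithZero.exp (-1))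
    (ι : L₂ →ₐ[k] L) {τ₂ : L₂ ≃ₐ[k] L₂} (hι : ∀ x, ι (τ₂ x) = (σ ^ r) (ι x))
    {f' : L₂ →ₐ[k] Module.End F V} {y' : Module.End F V} (h' : IsCyclicPair τ₂ s a f' y')
    (hlt : Module.finrank F V < s * Module.finrank k L₂) :
    ∃ (D : Type) (_ : DivisionRing D) (_ : Algebra k D),
      Module.finrank k D = N ^ 2 ∧ Subalgebra.center k D = ⊥ ∧
      Nonempty ((K ⊗[k] D) ≃ₐ[K] Matrix (Fin N) (Fin N) K) ∧
      ¬ ∀ x : F ⊗[k] D, x ≠ 0 → IsUnit x := by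
  have hN0 : 0 < N := by omega
  have hr : 0 < r := Nat.pos_of_ne_zero fun h => by simp [h] at hNrs; omega
  have hs : 0 < s := Nat.pos_of_ne_zero fun h => by simp [h] at hNrs; omega
  have hσN : σ ^ N = 1 := hσ ▸ pow_orderOf_eq_one σ
  have hσi : ∀ i, 0 < i → i < N → σ ^ i ≠ 1 := fun i hi hiN =>
    pow_ne_one_of_lt_orderOf hi.ne' (hσ ▸ hiN)
  have ha0 : a ≠ 0 := by
    rintro rfl
    rw [map_zero, map_zero] at ha
    exact WithZero.exp_ne_zero ha.symm
  have hp := diagHom_pair (a := a) hσN (AlgHom.id k L)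
  have hinj := diagHom_injective (a := a) (τ := σ) hN0 (AlgHom.id k L) Function.injective_id
  let D := hp.subalgebra hN0
  have hDrank : Module.finrank k D = N ^ 2 := by
    rw [hp.finrank_subalgebra hN0 hinj, hrank, sq]
  have hfin : FiniteDimensional k D := Module.finite_of_finrank_pos (by rw [hDrank]; positivity)
  have hnzd : NoZeroDivisors D := ⟨fun {x z} hxz => by
    by_contra! h
    exact hp.mul_ne_zero_of_valuation hN0 hinj hv ha x.2 z.2 (by simpa using h.1)
      (by simpa using h.2) (congrArg Subtype.val hxz)⟩
  have hnt : Nontrivial D := Module.nontrivial_of_finrank_pos (R := k) (by rw [hDrank]; positivity)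
  have hdom : IsDomain D := NoZeroDivisors.to_isDomain D
  refine ⟨D, divisionRingOfFiniteDimensional k D, inferInstance, hDrank,
    hp.center_subalgebra hN hinj hσi hfix, nonempty_splitting hrank hN ha0 hσN hσi ρ, ?_⟩
  have hq := hp.comp_pow ι τ₂ hNrs h'.pow_aut hι
  have hqinj := sumMap_comp_pow_injective hinj ι hr hNrs
  have hCrank := hq.finrank_subalgebra hs hqinj
  have : FiniteDimensional k (hq.subalgebra hs) := Module.finite_of_finrank_pos (by
    rw [hCrank]; exact Nat.mul_pos hs Module.finrank_pos)
  obtain ⟨g⟩ := hq.exists_algHom hs hqinj h'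
  have hle : hq.subalgebra hs ≤ D := by
    rintro _ ⟨c, rfl⟩
    exact ⟨_, (sumMap_comp_pow ι hr hNrs c).symm⟩
  exact not_forall_isUnit_of_finrank_lt (Subalgebra.inclusion hle)
    (Subalgebra.inclusion_injective hle) g (by rw [hCrank]; exact hlt)

open NumberField in
/-- An inert prime `p` of a number field yields a Galois-invariant discrete valuation for which
`p` is a uniformizer and every other prime number is a unit. -/
theorem exists_valuation_of_prime (L : Type*) [Field L] [NumberField L] {p p' : ℕ}
    (hp : Prime (p : 𝓞 L)) (hpp' : p.Coprime p') :
    ∃ v : Valuation L (WithZero (Multiplicative ℤ)), (∀ (σ : L ≃ₐ[ℚ] L) x, v (σ x) = v x) ∧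
      v (algebraMap ℚ L (p / p')) = WithZero.exp (-1) := by
  let P : IsDedekindDomain.HeightOneSpectrum (𝓞 L) :=
    ⟨Ideal.span {(p : 𝓞 L)}, (Ideal.span_singleton_prime hp.ne_zero).2 hp, by
      simpa using hp.ne_zero⟩
  have hP : ∀ (n : ℕ) (x : 𝓞 L),
      P.intValuation x ≤ WithZero.exp (-(n : ℤ)) ↔ (p : 𝓞 L) ^ n ∣ x := by
    intro n x
    rw [P.intValuation_le_pow_iff_mem, Ideal.span_singleton_pow, Ideal.mem_span_singleton]
  have hle : ∀ x z : 𝓞 L, z ≠ 0 → (∀ n : ℕ, (p : 𝓞 L) ^ n ∣ z → (p : 𝓞 L) ^ n ∣ x) →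
      P.intValuation x ≤ P.intValuation z := by
    intro x z hz h
    have h1 := P.intValuation_eq_exp_neg_multiplicity hz
    rw [h1]
    exact (hP _ _).2 (h _ ((hP _ _).1 h1.le))
  have hσ : ∀ (σ : L ≃ₐ[ℚ] L) (x : 𝓞 L),
      P.intValuation (RingOfIntegers.mapRingEquiv σ.toRingEquiv x) = P.intValuation x := by
    intro σ x
    set e := RingOfIntegers.mapRingEquiv σ.toRingEquiv
    rcases eq_or_ne x 0 with rfl | hx
    · rw [map_zero]
    refine le_antisymm (hle _ _ hx fun n hn => ?_)
      (hle _ _ (e.map_ne_zero_iff.2 hx) fun n hn => ?_)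
    · simpa using map_dvd e hn
    · simpa using map_dvd e.symm hn
  refine ⟨P.valuation L, fun σ x => ?_, ?_⟩
  · obtain ⟨b, c, hc, rfl⟩ := IsFractionRing.div_surjective (A := 𝓞 L) x
    have h1 : ∀ b : 𝓞 L, σ (algebraMap (𝓞 L) L b) =
      algebraMap (𝓞 L) L (RingOfIntegers.mapRingEquiv σ.toRingEquiv b) := fun b => rfl
    rw [map_div₀ σ, h1, h1, map_div₀, map_div₀, P.valuation_of_algebraMap, P.valuation_of_algebraMap,
      P.valuation_of_algebraMap, P.valuation_of_algebraMap, hσ, hσ]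
  · have hu : (p' : 𝓞 L) ∉ P.asIdeal := by
      intro h
      have h1 : (1 : 𝓞 L) ∈ P.asIdeal := by
        obtain ⟨u, w, huw⟩ := Nat.isCoprime_iff_coprime.2 hpp'
        have h2 : (u : 𝓞 L) * p + w * p' = 1 := by exact_mod_cast congrArg (Int.cast (R := 𝓞 L)) huw
        rw [← h2]
        exact P.asIdeal.add_mem (P.asIdeal.mul_mem_left _ (Ideal.mem_span_singleton_self _))
          (P.asIdeal.mul_mem_left _ h)
      exact P.isPrime.ne_top ((Ideal.eq_top_iff_one _).2 h1)
    have h3 : algebraMap ℚ L (p / p') =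
        algebraMap (𝓞 L) L (p : 𝓞 L) / algebraMap (𝓞 L) L (p' : 𝓞 L) := by simp
    rw [h3, map_div₀, P.valuation_of_algebraMap, P.intValuation_singleton hp.ne_zero rfl,
      P.valuation_eq_one_iff_notMem.2 hu, div_one]

open NumberField in
lemma finite_units_quotient_pow (K : Type*) [Field K] [NumberField K] {m : ℕ} (hm : 0 < m) :
    Finite ((𝓞 K)ˣ ⧸ (powMonoidHom m : (𝓞 K)ˣ →* (𝓞 K)ˣ).range) := by
  have : Group.FG ((𝓞 K)ˣ ⧸ (powMonoidHom m : (𝓞 K)ˣ →* (𝓞 K)ˣ).range) :=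
    @QuotientGroup.fg _ _ (Group.fg_iff_monoid_fg.2 inferInstance) _ _
  refine CommGroup.finite_of_fg_isMulTorsion _ fun x => ?_
  obtain ⟨u, rfl⟩ := QuotientGroup.mk_surjective x
  rw [isOfFinOrder_iff_pow_eq_one]
  exact ⟨m, hm, (QuotientGroup.eq_one_iff (u ^ m)).2 ⟨u, rfl⟩⟩

open NumberField in
/-- If infinitely many natural numbers generate norms of ideals, the quotient of two of them is
the norm of an element. -/
theorem exists_norm_eq_div (K E : Type*) [Field K] [NumberField K] [Field E] [NumberField E]
    [Algebra K E] {S : Set ℕ} (hS : S.Infinite) (hS0 : 0 ∉ S)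
    (h : ∀ p ∈ S, ∃ I : Ideal (𝓞 E), Ideal.relNorm (𝓞 K) I = Ideal.span {(p : 𝓞 K)}) :
    ∃ p ∈ S, ∃ p' ∈ S, p ≠ p' ∧ ∃ z : E, Algebra.norm K z = algebraMap ℚ K (p / p') := by
  have hcast : ∀ p ∈ S, (p : 𝓞 K) ≠ 0 := fun p hp => by
    rw [Nat.cast_ne_zero]; rintro rfl; exact hS0 hp
  choose! I hI using h
  have hI0 : ∀ p ∈ S, I p ∈ nonZeroDivisors (Ideal (𝓞 E)) := by
    intro p hp
    rw [mem_nonZeroDivisors_iff_ne_zero]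
    intro h0
    have := hI p hp
    rw [h0, Ideal.zero_eq_bot, Ideal.relNorm_bot, eq_comm, Ideal.span_singleton_eq_bot] at this
    exact hcast p hp this
  have hS' : Infinite S := hS.to_subtype
  obtain ⟨c, hc⟩ := Finite.exists_infinite_fiber
    (fun p : S => ClassGroup.mk0 (⟨I p, hI0 p p.2⟩ : nonZeroDivisors (Ideal (𝓞 E))))
  set T := (fun p : S => ClassGroup.mk0 (⟨I p, hI0 p p.2⟩ : nonZeroDivisors (Ideal (𝓞 E)))) ⁻¹' {c}
  obtain ⟨p₀⟩ : Nonempty T := inferInstance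
  have key : ∀ p : T, ∃ (x y : 𝓞 E) (u : (𝓞 K)ˣ), x ≠ 0 ∧ y ≠ 0 ∧
      Algebra.intNorm (𝓞 K) (𝓞 E) x * ((p : ℕ) : 𝓞 K) =
        Algebra.intNorm (𝓞 K) (𝓞 E) y * ((p₀ : ℕ) : 𝓞 K) * u := by
    intro p
    have h1 : ClassGroup.mk0 (⟨I p, hI0 p p.1.2⟩ : nonZeroDivisors (Ideal (𝓞 E))) =
        ClassGroup.mk0 ⟨I p₀, hI0 p₀ p₀.1.2⟩ := p.2.trans p₀.2.symm
    obtain ⟨x, y, hx, hy, hxy⟩ := ClassGroup.mk0_eq_mk0_iff.1 h1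
    have h2 := congrArg (Ideal.relNorm (𝓞 K)) hxy
    simp only [map_mul, Ideal.relNorm_singleton] at h2
    rw [hI p p.1.2, hI p₀ p₀.1.2, Ideal.span_singleton_mul_span_singleton,
      Ideal.span_singleton_mul_span_singleton, Ideal.span_singleton_eq_span_singleton] at h2
    obtain ⟨u, hu⟩ := h2.symm
    exact ⟨x, y, u, hx, hy, hu.symm⟩
  choose x y u hx hy hu using key
  have := finite_units_quotient_pow K (Module.finrank_pos : 0 < Module.finrank K E)
  obtain ⟨p, p', hne, hpp'⟩ := Finite.exists_ne_map_eq_of_infinite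
    (fun p : T => (u p : (𝓞 K)ˣ ⧸ (powMonoidHom (Module.finrank K E) : (𝓞 K)ˣ →* (𝓞 K)ˣ).range))
  obtain ⟨w, hw⟩ := QuotientGroup.eq.1 hpp'.symm
  have hw' : u p = u p' * w ^ Module.finrank K E := by
    rw [powMonoidHom_apply] at hw
    rw [hw]; group
  refine ⟨p, p.1.2, p', p'.1.2, fun h => hne (Subtype.ext (Subtype.ext h)), ?_⟩
  have hnorm : ∀ t : T, Algebra.norm K (x t : E) * ((t : ℕ) : K) =
      Algebra.norm K (y t : E) * ((p₀ : ℕ) : K) * ((u t : 𝓞 K) : K) := by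
    intro t
    have h0 : ∀ b : 𝓞 E, algebraMap (𝓞 K) K (Algebra.intNorm (𝓞 K) (𝓞 E) b) =
        Algebra.norm K (b : E) := Algebra.algebraMap_intNorm
    have := congrArg (algebraMap (𝓞 K) K) (hu t)
    simpa only [map_mul, h0, map_natCast] using this
  have hx0 : ∀ t, Algebra.norm K (x t : E) ≠ 0 := fun t =>
    Algebra.norm_ne_zero_iff.2 (by simpa using hx t)
  have hy0 : ∀ t, Algebra.norm K (y t : E) ≠ 0 := fun t =>
    Algebra.norm_ne_zero_iff.2 (by simpa using hy t)
  have hn0 : ∀ t : T, ((t : ℕ) : K) ≠ 0 := fun t => by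
    rw [Nat.cast_ne_zero]; intro h0; exact hS0 (h0 ▸ t.1.2)
  have hu0 : ((u p' : 𝓞 K) : K) ≠ 0 := by simp
  refine ⟨algebraMap K E ((w : 𝓞 K) : K) * (y p : E) * (x p' : E) / ((x p : E) * (y p' : E)), ?_⟩
  have hden : (x p : E) * (y p' : E) ≠ 0 := by simp [hx, hy]
  have hz := congrArg (Algebra.norm K) (div_mul_cancel₀
    (algebraMap K E ((w : 𝓞 K) : K) * (y p : E) * (x p' : E)) hden)
  rw [map_mul, map_mul, map_mul, map_mul, Algebra.norm_algebraMap] at hz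
  rw [eq_div_of_mul_eq (mul_ne_zero (hx0 _) (hy0 _)) hz]
  have h1 := hnorm p
  have h2 := hnorm p'
  have h3 : ((u p : 𝓞 K) : K) = (u p' : 𝓞 K) * ((w : 𝓞 K) : K) ^ Module.finrank K E := by
    rw [hw']; simp
  rw [h3] at h1
  rw [map_div₀, map_natCast, map_natCast, div_eq_div_iff (mul_ne_zero (hx0 _) (hy0 _)) (hn0 _)]
  apply mul_left_cancel₀ (mul_ne_zero (hn0 p₀) hu0)
  linear_combination (Algebra.norm K (y p : E) * ((w : 𝓞 K) : K) ^ Module.finrank K E *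
    ((p₀ : ℕ) : K) * ((u p' : 𝓞 K) : K)) * h2 - (Algebra.norm K (y p' : E)) *
    ((p₀ : ℕ) : K) * ((u p' : 𝓞 K) : K) * h1

open NumberField in
theorem absNorm_span_natCast_eq_pow (K : Type*) [Field K] [NumberField K] (p : ℕ) :
    Ideal.absNorm (Ideal.span {(p : 𝓞 K)}) = p ^ Module.finrank ℚ K := by
  rw [Ideal.absNorm_span_singleton, ← map_natCast (algebraMap ℤ (𝓞 K)), Algebra.norm_algebraMap,
    RingOfIntegers.rank]
  simp [Int.natAbs_pow]

open NumberField in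
/-- An automorphism acting trivially modulo an inert prime is trivial. -/
theorem eq_one_of_forall_dvd_sub (M : Type*) [Field M] [NumberField M] [IsGalois ℚ M] {p : ℕ}
    (hp : p.Prime) (hpM : Prime (p : 𝓞 M)) (σ : Gal(M/ℚ))
    (h : ∀ x : 𝓞 M, (p : 𝓞 M) ∣ σ • x - x) : σ = 1 := by
  have hprime : (Ideal.span {(p : ℤ)}).IsPrime := by
    rw [Ideal.span_singleton_prime (by exact_mod_cast hp.ne_zero)]
    exact Nat.prime_iff_prime_int.1 hp
  have hP : (Ideal.span {(p : 𝓞 M)}).IsPrime :=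
    (Ideal.span_singleton_prime hpM.ne_zero).2 hpM
  have hover : (Ideal.span {(p : 𝓞 M)}).LiesOver (Ideal.span {(p : ℤ)}) := by
    rw [Ideal.liesOver_span_iff hP.ne_top (Nat.prime_iff_prime_int.1 hp)]
    simp
  have hmax : (Ideal.span {(p : ℤ)}).IsMaximal := hprime.isMaximal (by simpa using hp.ne_zero)
  have hmax' : (Ideal.span {(p : 𝓞 M)}).IsMaximal := hP.isMaximal (by simpa using hp.ne_zero)
  have h1 := Ideal.ncard_primesOver_mul_card_inertia_mul_finrank (G := Gal(M/ℚ))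
    (Ideal.span {(p : ℤ)}) (Ideal.span {(p : 𝓞 M)})
  have h2 := Ideal.absNorm_eq_pow_inertiaDeg' (Ideal.span {(p : 𝓞 M)}) hp
  rw [absNorm_span_natCast_eq_pow, Ideal.inertiaDeg'_eq_inertiaDeg] at h2
  rw [← Nat.pow_right_injective hp.two_le h2, IsGalois.card_aut_eq_finrank] at h1
  have h3 := Nat.eq_of_mul_eq_mul_right Module.finrank_pos (h1.trans (one_mul _).symm)
  have h4 := Nat.eq_one_of_mul_eq_one_left h3
  rw [Subgroup.card_eq_one] at h4
  have : σ ∈ (Ideal.span {(p : 𝓞 M)}).inertia Gal(M/ℚ) := fun x =>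
    Ideal.mem_span_singleton.2 (h x)
  rwa [h4, Subgroup.mem_bot] at this

/-- A normal subfield is stable under endomorphisms. -/
theorem exists_galois_comp_eq {E M : Type*} [Field E] [CharZero E] [Field M] [CharZero M]
    [Normal ℚ M] (ι : M →+* E) (φ : E →+* E) : ∃ σ : Gal(M/ℚ), ∀ x, φ (ι x) = ι (σ x) := by
  let := ι.toAlgebra
  exact ⟨φ.toRatAlgHom.restrictNormal' M, fun x =>
    (AlgHom.restrictNormal_commutes φ.toRatAlgHom M x).symm⟩

theorem natCard_le_of_forall_pow_eq {k : Type*} [Field k] {q : ℕ} (hq : 1 < q)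
    (h : ∀ x : k, x ^ q = x) : Nat.card k ≤ q := by
  classical
  by_cases hk : Finite k
  · have := Fintype.ofFinite k
    rw [Nat.card_eq_fintype_card, ← Finset.card_univ, ← FiniteField.X_pow_card_sub_X_natDegree_eq k hq]
    refine Polynomial.card_le_degree_of_subset_roots fun x _ => ?_
    rw [Polynomial.mem_roots (FiniteField.X_pow_card_sub_X_ne_zero k hq)]
    simp [h x]
  · rw [not_finite_iff_infinite] at hk
    simp

open NumberField in
/-- If a Galois extension `E / K` is generated by a Galois extension `M / ℚ` with
`[M : ℚ] = [K : ℚ]`, then a prime number inert in `K` and in `M` has a prime of relative degree one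
above it in `E`. -/
theorem exists_relNorm_eq_span_of_prime (K E M : Type*) [Field K] [NumberField K] [Field E]
    [NumberField E] [Algebra K E] [IsGalois K E] [Field M] [NumberField M] [IsGalois ℚ M]
    (ι : M →+* E) (hgen : ∀ h : Gal(E/K), (∀ x, h (ι x) = ι x) → h = 1)
    (hrank : Module.finrank ℚ K = Module.finrank ℚ M) {p : ℕ} (hp : p.Prime)
    (hpK : Prime (p : 𝓞 K)) (hpM : Prime (p : 𝓞 M)) :
    ∃ I : Ideal (𝓞 E), Ideal.relNorm (𝓞 K) I = Ideal.span {(p : 𝓞 K)} := by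
  have hP : (Ideal.span {(p : 𝓞 K)}).IsPrime := (Ideal.span_singleton_prime hpK.ne_zero).2 hpK
  have hmax : (Ideal.span {(p : 𝓞 K)}).IsMaximal := hP.isMaximal (by simpa using hp.ne_zero)
  obtain ⟨Q, hQ, hQP⟩ := Ideal.exists_maximal_ideal_liesOver_of_isIntegral (S := 𝓞 E)
    (Ideal.span {(p : 𝓞 K)})
  have hpQ : (p : 𝓞 E) ∈ Q := by
    have : (p : 𝓞 K) ∈ Q.under (𝓞 K) := by
      rw [← hQP.over]; exact Ideal.mem_span_singleton_self _
    simpa [Ideal.mem_comap] using this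
  have hQ0 : Q ≠ ⊥ := fun h => hp.ne_zero (by simpa [h] using hpQ)
  have := Ring.HasFiniteQuotients.finiteQuotient hQ0
  obtain ⟨φ, hφ⟩ := IsArithFrobAt.exists_of_isInvariant (𝓞 K) Gal(E/K) Q
  have hcard : Nat.card (𝓞 K ⧸ Q.under (𝓞 K)) = p ^ Module.finrank ℚ K := by
    rw [← hQP.over, ← absNorm_span_natCast_eq_pow, Ideal.absNorm_apply, Submodule.cardQuot_apply]
  have hφ' : ∀ x : 𝓞 E, φ • x - x ^ p ^ Module.finrank ℚ K ∈ Q := fun x => by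
    rw [← hcard]; exact hφ x
  obtain ⟨σ, hσ⟩ := exists_galois_comp_eq ι (φ : E →+* E)
  let j : 𝓞 M →+* 𝓞 E := RingOfIntegers.mapRingHom ι
  have hPM : (Ideal.span {(p : 𝓞 M)}).IsPrime := (Ideal.span_singleton_prime hpM.ne_zero).2 hpM
  have hmaxM : (Ideal.span {(p : 𝓞 M)}).IsMaximal := hPM.isMaximal (by simpa using hp.ne_zero)
  have hcomap : Q.comap j = Ideal.span {(p : 𝓞 M)} := by
    refine (hmaxM.eq_of_le (hQ.isPrime.comap j).ne_top ?_).symm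
    rw [Ideal.span_singleton_le_iff_mem, Ideal.mem_comap, map_natCast]
    exact hpQ
  have hσ1 : σ = 1 := by
    refine eq_one_of_forall_dvd_sub M hp hpM σ fun x => ?_
    let := Ideal.Quotient.field (Ideal.span {(p : 𝓞 M)})
    have : Finite (𝓞 M ⧸ Ideal.span {(p : 𝓞 M)}) :=
      Ring.HasFiniteQuotients.finiteQuotient (by simpa using hp.ne_zero)
    have := Fintype.ofFinite (𝓞 M ⧸ Ideal.span {(p : 𝓞 M)})
    have h1 : x ^ p ^ Module.finrank ℚ K - x ∈ Ideal.span {(p : 𝓞 M)} := by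
      rw [← Ideal.Quotient.eq, map_pow, hrank, ← absNorm_span_natCast_eq_pow, Ideal.absNorm_apply,
        Submodule.cardQuot_apply, Nat.card_eq_fintype_card, FiniteField.pow_card]
    have h2 : σ • x - x ^ p ^ Module.finrank ℚ K ∈ Ideal.span {(p : 𝓞 M)} := by
      rw [← hcomap, Ideal.mem_comap, map_sub, map_pow]
      have : j (σ • x) = φ • j x := RingOfIntegers.ext (hσ x).symm
      rw [this]
      exact hφ' _
    rw [← Ideal.mem_span_singleton]
    simpa using add_mem h2 h1
  have hφ1 : φ = 1 := hgen φ fun x => by simpa [hσ1] using hσ x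
  have hle : Ideal.absNorm Q ≤ p ^ Module.finrank ℚ K := by
    rw [Ideal.absNorm_apply, Submodule.cardQuot_apply]
    let := Ideal.Quotient.field Q
    refine natCard_le_of_forall_pow_eq (Nat.one_lt_pow Module.finrank_pos.ne' hp.one_lt) fun x => ?_
    obtain ⟨x, rfl⟩ := Ideal.Quotient.mk_surjective x
    have := hφ' x
    rw [hφ1, one_smul] at this
    rw [← map_pow, eq_comm]
    exact Ideal.Quotient.eq.2 this
  obtain ⟨e, he⟩ := Ideal.exists_relNorm_eq_pow_of_isPrime Q (Ideal.span {(p : 𝓞 K)})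
  have hn := Ideal.absNorm_relNorm (𝓞 K) (𝓞 E) Q
  rw [he, map_pow, absNorm_span_natCast_eq_pow] at hn
  refine ⟨Q, ?_⟩
  rw [he]
  have h1 : 1 < p ^ Module.finrank ℚ K := Nat.one_lt_pow Module.finrank_pos.ne' hp.one_lt
  rw [← hn] at hle
  have he1 : e ≤ 1 := (Nat.pow_le_pow_iff_right h1).1 (by simpa using hle)
  have he0 : e ≠ 0 := by
    rintro rfl
    exact hQ.ne_top (Ideal.absNorm_eq_one_iff.1 (by simpa using hn.symm))
  rw [show e = 1 by lia, pow_one]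

open NumberField in
/-- A prime number all of whose residue fields are large is inert. -/
theorem prime_natCast_of_forall_le_absNorm (K : Type*) [Field K] [NumberField K] {p m : ℕ}
    (hp : p.Prime) (hm : Module.finrank ℚ K ≤ m)
    (h : ∀ P : Ideal (𝓞 K), P.IsMaximal → (p : 𝓞 K) ∈ P → p ^ m ≤ Ideal.absNorm P) :
    Module.finrank ℚ K = m ∧ Prime (p : 𝓞 K) := by
  have hne : Ideal.span {(p : 𝓞 K)} ≠ ⊤ := by
    rw [Ne, ← Ideal.absNorm_eq_one_iff, absNorm_span_natCast_eq_pow]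
    exact (Nat.one_lt_pow Module.finrank_pos.ne' hp.one_lt).ne'
  obtain ⟨P, hP, hle⟩ := Ideal.exists_le_maximal _ hne
  have hPm := h P hP (hle (Ideal.mem_span_singleton_self _))
  obtain ⟨J, hJ⟩ := Ideal.dvd_iff_le.2 hle
  have hN := congrArg Ideal.absNorm hJ
  rw [map_mul, absNorm_span_natCast_eq_pow] at hN
  have hpos : 0 < p ^ m := pow_pos hp.pos m
  have hle' : p ^ Module.finrank ℚ K ≤ p ^ m := Nat.pow_le_pow_right hp.pos hm
  have hJ0 : 0 < Ideal.absNorm J := by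
    rw [Nat.pos_iff_ne_zero]
    intro h0
    rw [h0, mul_zero] at hN
    exact (pow_pos hp.pos _).ne' hN
  have hJ1 : Ideal.absNorm J = 1 := by nlinarith
  rw [Ideal.absNorm_eq_one_iff] at hJ1
  rw [hJ1, Ideal.mul_top] at hJ
  refine ⟨le_antisymm hm ((Nat.pow_le_pow_iff_right hp.one_lt).1 ?_), ?_⟩
  · rwa [← hJ, absNorm_span_natCast_eq_pow] at hPm
  · rw [← Ideal.span_singleton_prime (by simpa using hp.ne_zero), hJ]
    exact hP.isPrime

open NumberField in
/-- An inert prime is inert in every subfield. -/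
theorem Prime.natCast_of_ringHom {L Z : Type*} [Field L] [NumberField L] [Field Z] [NumberField Z]
    (ι : L →+* Z) {p : ℕ} (hp : Prime (p : 𝓞 Z)) : Prime (p : 𝓞 L) := by
  have hp0 : (p : L) ≠ 0 := by
    rw [Nat.cast_ne_zero]; rintro rfl; exact hp.ne_zero (by simp)
  let j : 𝓞 L →+* 𝓞 Z := RingOfIntegers.mapRingHom ι
  have hdvd : ∀ x : 𝓞 L, (p : 𝓞 Z) ∣ j x → (p : 𝓞 L) ∣ x := by
    rintro x ⟨y, hy⟩
    have hy' : ι x = p * (y : Z) := by simpa [j] using congrArg (algebraMap (𝓞 Z) Z) hy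
    have hint : IsIntegral ℤ ((x : L) / p) := by
      rw [← isIntegral_algHom_iff ι.toIntAlgHom ι.injective]
      have : ι ((x : L) / p) = y := by
        rw [map_div₀, map_natCast, hy', mul_div_cancel_left₀]
        rw [← map_natCast ι]
        exact (map_ne_zero ι).2 hp0
      exact this ▸ y.isIntegral_coe
    obtain ⟨w, hw⟩ : ∃ w : 𝓞 L, algebraMap (𝓞 L) L w = algebraMap (𝓞 L) L x / p := ⟨⟨_, hint⟩, rfl⟩
    refine ⟨w, RingOfIntegers.coe_injective ?_⟩
    rw [map_mul, map_natCast, hw, mul_div_cancel₀ _ hp0]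
  refine ⟨fun h => hp0 (by simpa using congrArg (algebraMap (𝓞 L) L) h), fun h => hp.not_isUnit ?_,
    fun a b hab => ?_⟩
  · simpa using h.map j
  · have := map_dvd j hab
    rw [map_mul, map_natCast] at this
    exact (hp.dvd_or_dvd this).imp (hdvd a) (hdvd b)

open NumberField in
/-- A primitive root modulo a prime `q` is inert in the `q`-th cyclotomic field. -/
theorem prime_natCast_of_isCyclotomicExtension (Z : Type*) [Field Z] [NumberField Z] {p q : ℕ}
    [IsCyclotomicExtension {q} ℚ Z] (hp : p.Prime) (hq : q.Prime) (hpq : p ≠ q)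
    (h : orderOf (p : ZMod q) = q - 1) : Prime (p : 𝓞 Z) := by
  have : Fact p.Prime := ⟨hp⟩
  have : NeZero q := ⟨hq.ne_zero⟩
  have hprime : (Ideal.span {(p : ℤ)}).IsPrime := by
    rw [Ideal.span_singleton_prime (by exact_mod_cast hp.ne_zero)]
    exact Nat.prime_iff_prime_int.1 hp
  have hmax : (Ideal.span {(p : ℤ)}).IsMaximal := hprime.isMaximal (by simpa using hp.ne_zero)
  refine (prime_natCast_of_forall_le_absNorm Z (m := q - 1) hp ?_ fun P hP hpP => ?_).2
  · rw [IsCyclotomicExtension.finrank Z (Polynomial.cyclotomic.irreducible_rat hq.pos),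
      Nat.totient_prime hq]
  · have : P.LiesOver (Ideal.span {(p : ℤ)}) := by
      rw [Ideal.liesOver_span_iff hP.ne_top (Nat.prime_iff_prime_int.1 hp)]
      simpa using hpP
    rw [Ideal.absNorm_eq_pow_inertiaDeg' P hp, Ideal.inertiaDeg'_eq_inertiaDeg,
      IsCyclotomicExtension.Rat.inertiaDeg_eq_of_not_dvd p Z P
        (fun hdvd => hpq ((Nat.prime_dvd_prime_iff_eq hp hq).1 hdvd)), h]

theorem pow_half_eq_neg_one {k : Type*} [Field k] {p : ℕ} [Fact p.Prime] [CharP k p] {a : ℤ}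
    (h : legendreSym p a = -1) : (a : k) ^ (p / 2) = -1 := by
  have := congrArg (ZMod.castHom dvd_rfl k) (legendreSym.eq_pow p a)
  rw [h] at this
  simpa using this.symm

/-- If `θ ^ m = -1` then the order of the multiplicative group is more divisible by `2` than `m`. -/
theorem padicValNat_two_lt_of_pow_eq_neg_one {k : Type*} [Field k] [NeZero (2 : k)] {θ : k} {m c : ℕ}
    (hc : c ≠ 0) (hm : θ ^ m = -1) (hθ : θ ^ c = 1) : padicValNat 2 m < padicValNat 2 c := by
  by_contra! hle
  obtain ⟨u, hu⟩ := pow_padicValNat_dvd (p := 2) (n := c)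
  have hodd : Odd u := by
    rw [← Nat.not_even_iff_odd, even_iff_two_dvd]
    rintro ⟨w, rfl⟩
    exact pow_succ_padicValNat_not_dvd (p := 2) hc ⟨w, hu.trans (by ring)⟩
  obtain ⟨w, hw⟩ : 2 ^ padicValNat 2 c ∣ m := (pow_dvd_pow 2 hle).trans pow_padicValNat_dvd
  have h1 : θ ^ (m * u) = -1 := by rw [pow_mul, hm, hodd.neg_one_pow]
  rw [hw, mul_right_comm, ← hu, pow_mul, hθ, one_pow] at h1
  exact two_ne_zero (α := k) (by linear_combination h1)

theorem two_pow_dvd_of_pow_two_pow_eq {k : Type*} [Field k] {p f j : ℕ} [hp : Fact p.Prime]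
    [CharP k p] [Finite k] (hcard : Nat.card k = p ^ f) (hp4 : p % 4 = 3) {D t : ℤ} {δ θ : k}
    (hδ : δ ^ 2 = D) (hθ : θ ^ 2 ^ j = t + δ) (hD : legendreSym p D = -1)
    (ht : legendreSym p (t ^ 2 - D) = -1) : 2 ^ (j + 1) ∣ f := by
  have hp2 : p = 2 * (p / 2) + 1 := by lia
  have hodd : Odd (p / 2) := by rw [Nat.odd_iff]; lia
  have : NeZero (2 : k) := ⟨Ring.two_ne_zero (by rw [ringChar.eq k p]; lia)⟩
  have hδp : δ ^ p = -δ := by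
    conv_lhs => rw [hp2, pow_succ, pow_mul, hδ, pow_half_eq_neg_one hD]
    ring
  have htp : (t : k) ^ p = t := by
    have := congrArg (ZMod.castHom dvd_rfl k) (ZMod.pow_card (t : ZMod p))
    simpa only [map_pow, map_intCast] using this
  have hγ : (t + δ) ^ (p + 1) = ((t ^ 2 - D : ℤ) : k) := by
    rw [pow_succ, add_pow_char, htp, hδp]
    push_cast
    linear_combination -hδ
  have hm : θ ^ (2 ^ j * (p + 1) * (p / 2)) = -1 := by
    rw [pow_mul, pow_mul, hθ, hγ, pow_half_eq_neg_one ht]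
  have hf : f ≠ 0 := by
    rintro rfl
    have := Finite.one_lt_card (α := k)
    lia
  have hc : p ^ f - 1 ≠ 0 := (Nat.sub_pos_of_lt (Nat.one_lt_pow hf hp.1.one_lt)).ne'
  have hθ0 : θ ≠ 0 := by
    rintro rfl
    rw [zero_pow (by have := Nat.pos_of_ne_zero hodd.pos.ne'; positivity)] at hm
    exact neg_ne_zero.2 one_ne_zero hm.symm
  have hθc : θ ^ (p ^ f - 1) = 1 := by
    have := Fintype.ofFinite k
    rw [← hcard, Nat.card_eq_fintype_card]
    exact FiniteField.pow_card_sub_one_eq_one θ hθ0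
  have hlt := padicValNat_two_lt_of_pow_eq_neg_one hc hm hθc
  have h2 : padicValNat 2 (p / 2) = 0 := padicValNat.eq_zero_of_not_dvd hodd.not_two_dvd_nat
  rw [padicValNat.mul (by positivity) hodd.pos.ne', padicValNat.mul (by positivity) (by positivity),
    padicValNat.prime_pow, h2] at hlt
  have hp1 : 1 ≤ padicValNat 2 (p + 1) := one_le_padicValNat_of_dvd (by positivity) (by lia)
  have heven : Even f := by
    by_contra hne
    rw [Nat.not_even_iff_odd] at hne
    have h4 : 2 ^ 2 ∣ p ^ f - 1 := (pow_dvd_pow 2 (by lia)).trans pow_padicValNat_dvd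
    obtain ⟨g, rfl⟩ := hne
    have : p ^ (2 * g + 1) % 4 = 3 := by
      rw [pow_succ, pow_mul, Nat.mul_mod, Nat.pow_mod, Nat.pow_mod p, hp4]
      simp
    lia
  have hlte := padicValNat.pow_two_sub_pow (x := p) (y := 1) hp.1.one_lt (by lia) (by lia) hf heven
  have hpm : padicValNat 2 (p - 1) = 1 := by
    rw [show p - 1 = 2 * (p / 2) by lia, padicValNat.mul (by lia) hodd.pos.ne', h2]
    simp
  rw [one_pow, hpm] at hlte
  exact (pow_dvd_pow 2 (by lia)).trans pow_padicValNat_dvd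

open NumberField in
/-- A number field of degree at most `2 ^ (j + 1)` generated by a `2 ^ j`-th root of
`t + √D` has degree exactly `2 ^ (j + 1)`, and a prime `p ≡ 3 [MOD 4]` modulo which neither `D` nor
`t ^ 2 - D` is a square is inert in it. -/
theorem prime_natCast_of_pow_two_pow_eq (K : Type*) [Field K] [NumberField K] {p j : ℕ}
    [hp : Fact p.Prime] (hK : Module.finrank ℚ K ≤ 2 ^ (j + 1)) (hp4 : p % 4 = 3) {D t : ℤ}
    {δ θ : K} (hδ : δ ^ 2 = D) (hθ : θ ^ 2 ^ j = t + δ) (hD : legendreSym p D = -1)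
    (ht : legendreSym p (t ^ 2 - D) = -1) :
    Module.finrank ℚ K = 2 ^ (j + 1) ∧ Prime (p : 𝓞 K) := by
  refine prime_natCast_of_forall_le_absNorm K hp.1 hK fun P hP hpP => ?_
  have hδi : IsIntegral ℤ δ := IsIntegral.of_pow two_pos (by
    rw [hδ, ← eq_intCast (algebraMap ℤ K)]; exact isIntegral_algebraMap)
  have hθi : IsIntegral ℤ θ := IsIntegral.of_pow (n := 2 ^ j) (by positivity) (by
    rw [hθ, ← eq_intCast (algebraMap ℤ K)]; exact isIntegral_algebraMap.add hδi)
  obtain ⟨δ', rfl⟩ : ∃ w : 𝓞 K, algebraMap (𝓞 K) K w = δ := ⟨⟨_, hδi⟩, rfl⟩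
  obtain ⟨θ', rfl⟩ : ∃ w : 𝓞 K, algebraMap (𝓞 K) K w = θ := ⟨⟨_, hθi⟩, rfl⟩
  have hδ' : δ' ^ 2 = D := RingOfIntegers.coe_injective (by
    rw [map_pow, hδ, map_intCast])
  have hθ' : θ' ^ 2 ^ j = t + δ' := RingOfIntegers.coe_injective (by
    rw [map_pow, hθ, map_add, map_intCast])
  have hover : P.LiesOver (Ideal.span {(p : ℤ)}) := by
    rw [Ideal.liesOver_span_iff hP.ne_top (Nat.prime_iff_prime_int.1 hp.1)]
    simpa using hpP
  have hP0 : P ≠ ⊥ := fun h => hp.1.ne_zero (by simpa [h] using hpP)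
  have hcard := Ideal.absNorm_eq_pow_inertiaDeg' P hp.1
  let := Ideal.Quotient.field P
  have : Finite (𝓞 K ⧸ P) := Ring.HasFiniteQuotients.finiteQuotient hP0
  have : CharP (𝓞 K ⧸ P) p := by
    obtain ⟨c, hc⟩ := CharP.exists (𝓞 K ⧸ P)
    have hcp : c ∣ p := by
      rw [← CharP.cast_eq_zero_iff (𝓞 K ⧸ P) c, ← map_natCast (Ideal.Quotient.mk P)]
      exact Ideal.Quotient.eq_zero_iff_mem.2 hpP
    rwa [← ((Nat.dvd_prime hp.1).1 hcp).resolve_left (CharP.char_ne_one (𝓞 K ⧸ P) c)]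
  have hdvd := two_pow_dvd_of_pow_two_pow_eq (k := 𝓞 K ⧸ P) (p := p) (j := j)
    (hcard.symm ▸ (Ideal.absNorm_apply P).symm) hp4 (δ := Ideal.Quotient.mk P δ')
    (θ := Ideal.Quotient.mk P θ') (by rw [← map_pow, hδ', map_intCast])
    (by rw [← map_pow, hθ', map_add, map_intCast]) hD ht
  rw [hcard]
  have hprime : (Ideal.span {(p : ℤ)}).IsPrime := by
    rw [Ideal.span_singleton_prime (by exact_mod_cast hp.1.ne_zero)]
    exact Nat.prime_iff_prime_int.1 hp.1
  have hmax : (Ideal.span {(p : ℤ)}).IsMaximal := hprime.isMaximal (by simpa using hp.1.ne_zero)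
  exact Nat.pow_le_pow_right hp.1.pos (Nat.le_of_dvd (Ideal.inertiaDeg'_pos _ P) hdvd)

open NumberTheorySymbols in
theorem jacobiSym_eq_one_of_dvd_add_one {r b : ℕ} (hr : r ≠ 0) (h : 4 * r ∣ b + 1) :
    J(r | b) = 1 := by
  have hb : Odd b := by
    obtain ⟨c, hc⟩ := h
    rw [Nat.odd_iff]
    have : b + 1 = 2 * (2 * r * c) := by rw [hc]; ring
    lia
  have hmod : b % (4 * r) = 4 * r - 1 := by
    obtain ⟨c, hc⟩ := h
    rcases c with _ | c
    · lia
    · have hb' : b = (4 * r - 1) + 4 * r * c := by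
        rw [Nat.mul_succ] at hc; lia
      rw [hb', Nat.add_mul_mod_self_left, Nat.mod_eq_of_lt (by lia)]
  rw [jacobiSym.mod_right' r hb, hmod]
  have h4 : J(2 ^ 2 | 4 * r - 1) = 1 := by
    refine jacobiSym.sq_one' ?_
    rw [← Int.isCoprime_iff_gcd_eq_one]
    exact ⟨2 * r, -1, by push_cast [Nat.cast_sub (show 1 ≤ 4 * r by lia)]; ring⟩
  have h1 : J(2 ^ 2 * r | 4 * r - 1) = 1 := by
    rw [← jacobiSym.one_left (4 * r - 1)]
    refine jacobiSym.mod_left' (Int.ModEq.symm ?_)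
    rw [Int.modEq_iff_dvd]
    exact ⟨1, by push_cast [Nat.cast_sub (show 1 ≤ 4 * r by lia)]; ring⟩
  rw [jacobiSym.mul_left, h4, one_mul] at h1
  exact h1

theorem exists_sq_add_eq_mul_not_dvd {q d : ℕ} [hq : Fact q.Prime] (hq2 : q ≠ 2) (hqd : ¬ q ∣ d)
    (h : legendreSym q (-d) = 1) : ∃ t r : ℕ, t ^ 2 + d = q * r ∧ ¬ q ∣ r := by
  have h0 : ((-d : ℤ) : ZMod q) ≠ 0 := by
    push_cast
    rwa [neg_ne_zero, Ne, ZMod.natCast_eq_zero_iff]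
  obtain ⟨x, hx⟩ := (legendreSym.eq_one_iff q h0).1 h
  have hx' : q ∣ x.val ^ 2 + d := by
    rw [← ZMod.natCast_eq_zero_iff]
    push_cast at hx ⊢
    rw [ZMod.natCast_zmod_val, sq, ← hx]
    ring
  obtain ⟨r, hr⟩ := hx'
  by_cases hqr : q ∣ r
  · refine ⟨x.val + q, r + 2 * x.val + q, by linear_combination hr, fun hdvd => hqd ?_⟩
    have h1 : q ∣ 2 * x.val := by
      rw [Nat.dvd_add_left dvd_rfl] at hdvd
      exact (Nat.dvd_add_right hqr).1 hdvd
    have h2 : q ∣ x.val := by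
      refine (hq.1.dvd_mul.1 h1).resolve_left fun h2 => hq2 ?_
      exact (Nat.prime_dvd_prime_iff_eq hq.1 Nat.prime_two).1 h2
    exact (Nat.dvd_add_right (h2.pow two_ne_zero)).1 ⟨r, hr⟩
  · exact ⟨x.val, r, hr, hqr⟩

theorem exists_orderOf_natCast_eq (q : ℕ) [hq : Fact q.Prime] :
    ∃ u : ℕ, u.Coprime q ∧ orderOf (u : ZMod q) = q - 1 := by
  obtain ⟨g, hg⟩ := IsCyclic.exists_generator (α := (ZMod q)ˣ)
  refine ⟨(g : ZMod q).val, ZMod.val_coe_unit_coprime g, ?_⟩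
  rw [ZMod.natCast_zmod_val, orderOf_units, orderOf_eq_card_of_forall_mem_zpowers hg,
    Nat.card_eq_fintype_card, ZMod.card_units]

theorem legendreSym_eq_neg_one_of_orderOf {q p : ℕ} [hq : Fact q.Prime] (hq2 : q ≠ 2)
    (h : orderOf (p : ZMod q) = q - 1) : legendreSym q p = -1 := by
  have h2 := hq.1.two_le
  have h0 : ((p : ℤ) : ZMod q) ≠ 0 := by
    intro h0
    push_cast at h0
    have := pow_orderOf_eq_one (p : ZMod q)
    rw [h, h0, zero_pow (by lia)] at this
    exact zero_ne_one this
  refine (legendreSym.eq_one_or_neg_one q h0).resolve_left fun h1 => ?_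
  have := legendreSym.eq_pow q p
  rw [h1] at this
  have := orderOf_dvd_of_pow_eq_one (x := (p : ZMod q)) (n := q / 2) (by simpa using this.symm)
  rw [h] at this
  have := Nat.le_of_dvd (by lia) this
  lia

open NumberTheorySymbols in
theorem exists_infinite_inert_primes {d N : ℕ} (hd : d ≠ 0) (hN : N ≠ 0) :
    ∃ q : ℕ, q.Prime ∧ N ∣ q - 1 ∧ ∃ t : ℕ, Set.Infinite {p : ℕ | p.Prime ∧ p % 4 = 3 ∧ p ≠ q ∧
      orderOf (p : ZMod q) = q - 1 ∧ J(-d | p) = -1 ∧ J(t ^ 2 + d | p) = -1} := by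
  obtain ⟨q, hq, hqd, hq1⟩ := Nat.exists_prime_gt_modEq_one (k := 4 * d * N) (d + 2) (by positivity)
  have : Fact q.Prime := ⟨hq⟩
  have hq1' : 4 * d * N ∣ q - 1 := (Nat.modEq_iff_dvd' hq.one_le).1 hq1.symm
  have hq4 : q % 4 = 1 := by
    have := (dvd_mul_of_dvd_left (dvd_mul_right 4 d) N).trans hq1'
    lia
  have hndvd : ¬ q ∣ d := fun h => by have := Nat.le_of_dvd (by lia) h; lia
  have hqodd : Odd q := hq.odd_of_ne_two (by lia)
  have hleg : legendreSym q (-d) = 1 := by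
    rw [jacobiSym.legendreSym.to_jacobiSym, jacobiSym.mod_right _ hqodd, Int.natAbs_neg, Int.natAbs_natCast]
    have : q % (4 * d) = 1 := by
      have : q ≡ 1 [MOD 4 * d] := hq1.of_mul_right N
      rw [this, Nat.mod_eq_of_lt (by lia)]
    rw [this, jacobiSym.one_right]
  obtain ⟨t, r, htr, hqr⟩ := exists_sq_add_eq_mul_not_dvd (by lia) hndvd hleg
  have hr : r ≠ 0 := fun h => hqr (h ▸ dvd_zero q)
  obtain ⟨u, huq, hu⟩ := exists_orderOf_natCast_eq q
  have hcop : q.Coprime (4 * d * r) := by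
    refine (Nat.Prime.coprime_iff_not_dvd hq).2 fun h => ?_
    rcases hq.dvd_mul.1 h with h | h
    · rcases hq.dvd_mul.1 h with h | h
      · have := Nat.le_of_dvd (by lia) h
        have : q = 3 ∨ q = 4 := by lia
        lia
      · exact hndvd h
    · exact hqr h
  have hm0 : 4 * d * r ≠ 0 := by positivity
  obtain ⟨a, haq, ham⟩ := Nat.chineseRemainder hcop u (4 * d * r - 1)
  have haco : a.Coprime (q * (4 * d * r)) := by
    refine Nat.Coprime.mul_right ?_ ?_
    · rw [Nat.Coprime, haq.gcd_eq]; exact huq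
    · rw [Nat.Coprime, ham.gcd_eq]
      exact (Nat.coprime_self_sub_left (by lia)).2 (Nat.coprime_one_left _)
  refine ⟨q, hq, (dvd_mul_left N _).trans hq1', t, (Nat.infinite_setOfPred_prime_and_modEq
    (mul_ne_zero hq.ne_zero hm0) haco).mono ?_⟩
  rintro p ⟨hp, hpa⟩
  have hpq : p ≡ u [MOD q] := (hpa.of_mul_right _).trans haq
  have hpm : 4 * d * r ∣ p + 1 := by
    have := ((hpa.of_mul_left _).trans ham).add_right 1
    rw [Nat.sub_add_cancel (by lia)] at this
    exact (Nat.modEq_zero_iff_dvd.1 (this.trans (by simp [Nat.ModEq])))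
  have hp4 : p % 4 = 3 := by
    have := (dvd_mul_of_dvd_left (dvd_mul_right 4 d) r).trans hpm
    lia
  have hpodd : Odd p := by rw [Nat.odd_iff]; lia
  have hord : orderOf (p : ZMod q) = q - 1 := by
    rw [← hu, (ZMod.natCast_eq_natCast_iff p u q).2 hpq]
  refine ⟨hp, hp4, fun h => by lia, hord, ?_, ?_⟩
  · rw [neg_eq_neg_one_mul, jacobiSym.mul_left, jacobiSym.at_neg_one hpodd,
      jacobiSym_eq_one_of_dvd_add_one hd ((dvd_mul_right _ _).trans hpm),
      ZMod.χ₄_nat_three_mod_four hp4, mul_one]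
  · have : (t ^ 2 + d : ℤ) = (q : ℕ) * (r : ℕ) := by exact_mod_cast htr
    rw [this, jacobiSym.mul_left, jacobiSym_eq_one_of_dvd_add_one hr
      ((mul_dvd_mul_right (dvd_mul_right 4 d) r).trans hpm),
      jacobiSym.quadratic_reciprocity_one_mod_four hq4 hpodd, ← jacobiSym.legendreSym.to_jacobiSym,
      legendreSym_eq_neg_one_of_orderOf (by lia) hord, mul_one]

open IntermediateField in
theorem exists_cyclic_intermediateField {k Z : Type*} [Field k] [Field Z] [Algebra k Z]
    [FiniteDimensional k Z] [IsGalois k Z] {g : Gal(Z/k)} (hg : ∀ x, x ∈ Subgroup.zpowers g)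
    {M : ℕ} (hM : M ∣ Module.finrank k Z) :
    ∃ E : IntermediateField k Z, Module.finrank k E = M ∧ IsGalois k E ∧
      (∀ x ∈ E, (g ^ M) x = x) ∧
      ∃ τ : Gal(E/k), (∀ y, y ∈ Subgroup.zpowers τ) ∧ ∀ x : E, ((τ x : E) : Z) = g x := by
  have hcomm : ∀ x y : Gal(Z/k), x * y = y * x := fun x y => by
    obtain ⟨i, rfl⟩ := hg x
    obtain ⟨j, rfl⟩ := hg y
    exact (Commute.refl g).zpow_zpow i j
  have hord : orderOf g = Module.finrank k Z := by
    rw [orderOf_eq_card_of_forall_mem_zpowers hg, IsGalois.card_aut_eq_finrank]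
  let H := Subgroup.zpowers (g ^ M)
  have hn : H.Normal := ⟨fun n hn x => by rwa [hcomm x n, mul_inv_cancel_right]⟩
  have hpos : 0 < Module.finrank k Z := Module.finrank_pos
  have hgal : IsGalois k (fixedField H) := inferInstance
  refine ⟨fixedField H, ?_, hgal, fun x hx => ?_,
    AlgEquiv.restrictNormalHom (fixedField H) g, fun y => ?_, fun x => ?_⟩
  · have h1 := finrank_fixedField_eq_card H
    rw [Nat.card_zpowers, orderOf_pow_of_dvd (by rintro rfl; simp at hM; lia) (hord ▸ hM), hord] at h1
    have h2 := Module.finrank_mul_finrank k (fixedField H) Z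
    rw [h1] at h2
    obtain ⟨c, hc⟩ := hM
    rw [hc] at h2 hpos
    have hM0 : 0 < M := Nat.pos_of_mul_pos_right hpos
    rw [Nat.mul_div_cancel_left _ hM0] at h2
    exact Nat.eq_of_mul_eq_mul_right (Nat.pos_of_mul_pos_left hpos) h2
  · exact (mem_fixedField_iff H x).1 hx _ (Subgroup.mem_zpowers _)
  · obtain ⟨x, rfl⟩ := AlgEquiv.restrictNormalHom_surjective (F := k) (K₁ := fixedField H) Z y
    obtain ⟨i, rfl⟩ := hg x
    exact ⟨i, (map_zpow _ _ _).symm⟩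
  · exact AlgEquiv.restrictNormal_commutes g (fixedField H) x

theorem mem_range_algebraMap_of_generator {k L : Type*} [Field k] [Field L] [Algebra k L]
    [FiniteDimensional k L] [IsGalois k L] {g : Gal(L/k)} (hg : ∀ x, x ∈ Subgroup.zpowers g)
    {l : L} (h : g l = l) : l ∈ Set.range (algebraMap k L) := by
  rw [IsGalois.mem_range_algebraMap_iff_fixed]
  intro f
  have : Subgroup.zpowers g ≤ MulAction.stabilizer Gal(L/k) l := by
    rw [Subgroup.zpowers_le, MulAction.mem_stabilizer_iff]
    exact h
  exact this (hg f)

theorem isCyclic_galois_of_isCyclotomicExtension (Z : Type*) [Field Z] [CharZero Z] {q : ℕ}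
    (hq : q.Prime) [IsCyclotomicExtension {q} ℚ Z] : IsCyclic Gal(Z/ℚ) := by
  have : Fact q.Prime := ⟨hq⟩
  let e := IsCyclotomicExtension.autEquivPow (n := q) Z (Polynomial.cyclotomic.irreducible_rat hq.pos)
  exact isCyclic_of_surjective e.symm e.symm.surjective

open NumberField in
theorem exists_ringHom_real {Z L : Type*} [Field Z] [NumberField Z] [IsGalois ℚ Z] [Field L]
    {g : Gal(Z/ℚ)} (hg : ∀ x, x ∈ Subgroup.zpowers g) {N : ℕ}
    (hN : 2 * N ∣ Module.finrank ℚ Z) (j : L →+* Z) (hj : ∀ x, (g ^ N) (j x) = j x) :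
    Nonempty (L →+* ℝ) := by
  obtain ⟨ψ⟩ : Nonempty (Z →+* ℂ) := inferInstance
  obtain ⟨c, hc⟩ := exists_galois_comp_eq ψ (starRingEnd ℂ)
  have hc2 : c ^ 2 = 1 := by
    ext x
    apply ψ.injective
    rw [pow_two, AlgEquiv.mul_apply, ← hc, ← hc, Complex.conj_conj, AlgEquiv.one_apply]
  have hord : orderOf g = Module.finrank ℚ Z := by
    rw [orderOf_eq_card_of_forall_mem_zpowers hg, IsGalois.card_aut_eq_finrank]
  obtain ⟨i, rfl⟩ := hg c
  have hi : (2 * N : ℤ) ∣ i * 2 := by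
    have h1 : g ^ (i * 2) = 1 := by rw [zpow_mul]; exact_mod_cast hc2
    have h2 := orderOf_dvd_iff_zpow_eq_one.2 h1
    rw [hord] at h2
    exact (Int.natCast_dvd_natCast.2 hN).trans h2
  obtain ⟨w, hw⟩ := hi
  have hi' : i = N * w := by linarith
  have hfix : ∀ x, (g ^ i) (j x) = j x := fun x => by
    have : Subgroup.zpowers (g ^ N) ≤ MulAction.stabilizer Gal(Z/ℚ) (j x) := by
      rw [Subgroup.zpowers_le, MulAction.mem_stabilizer_iff]
      exact hj x
    refine this ⟨w, ?_⟩
    simp [hi', zpow_mul]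
  have hreal : ComplexEmbedding.IsReal (ψ.comp j) := by
    ext x
    simpa [hfix] using hc (j x)
  exact ⟨hreal.embedding⟩

theorem exists_cyclic_numberField {Z : Type} [Field Z] [NumberField Z] [IsGalois ℚ Z]
    {g : Gal(Z/ℚ)} (hg : ∀ x, x ∈ Subgroup.zpowers g) {M : ℕ} (hM : M ∣ Module.finrank ℚ Z) :
    ∃ (L : Type) (_ : Field L) (_ : NumberField L), Module.finrank ℚ L = M ∧ IsGalois ℚ L ∧
      ∃ (j : L →+* Z) (τ : Gal(L/ℚ)), (∀ x, (g ^ M) (j x) = j x) ∧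
        (∀ y, y ∈ Subgroup.zpowers τ) ∧ ∀ x, j (τ x) = g (j x) := by
  have key : ∃ (L : Type) (_ : Field L) (_ : CharZero L) (_ : Algebra ℚ L),
      FiniteDimensional ℚ L ∧ Module.finrank ℚ L = M ∧ IsGalois ℚ L ∧
      ∃ (j : L →+* Z) (τ : Gal(L/ℚ)), (∀ x, (g ^ M) (j x) = j x) ∧
        (∀ y, y ∈ Subgroup.zpowers τ) ∧ ∀ x, j (τ x) = g (j x) := by
    obtain ⟨E, h1, h2, h4, τ, h5, h6⟩ := exists_cyclic_intermediateField hg hM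
    exact ⟨E, inferInstance, inferInstance, inferInstance, inferInstance, h1, h2,
      algebraMap E Z, τ, fun x => h4 x x.2, h5, h6⟩
  obtain ⟨L, hF, hC, hA, hfin, h⟩ := key
  obtain rfl : hA = DivisionRing.toRatAlgebra := Subsingleton.elim _ _
  exact ⟨L, hF, ⟨⟩, h⟩

open NumberField in
theorem exists_cyclic_tower {q N s : ℕ} (hq : q.Prime) (hqN : 2 * N ∣ q - 1)
    (hs : s ∣ N) :
    ∃ (L : Type) (_ : Field L) (_ : NumberField L) (L₂ : Type) (_ : Field L₂) (_ : NumberField L₂),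
      Module.finrank ℚ L = N ∧ Module.finrank ℚ L₂ = s ∧ IsGalois ℚ L₂ ∧ Nonempty (L →+* ℝ) ∧
      (∀ p : ℕ, p.Prime → p ≠ q → orderOf (p : ZMod q) = q - 1 →
        Prime (p : 𝓞 L) ∧ Prime (p : 𝓞 L₂)) ∧
      ∃ (σ : Gal(L/ℚ)) (τ : Gal(L₂/ℚ)) (ι : L₂ →+* L), orderOf σ = N ∧
        (∀ l, σ l = l → l ∈ Set.range (algebraMap ℚ L)) ∧
        (∀ y, y ∈ Subgroup.zpowers τ) ∧ ∀ x, ι (τ x) = σ (ι x) := by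
  have : NeZero q := ⟨hq.ne_zero⟩
  obtain ⟨Z, _, _, _⟩ : ∃ (Z : Type) (_ : Field Z) (_ : CharZero Z), IsCyclotomicExtension {q} ℚ Z := by
    have key : ∃ (Z : Type) (_ : Field Z) (_ : CharZero Z) (_ : Algebra ℚ Z),
        IsCyclotomicExtension {q} ℚ Z :=
      ⟨CyclotomicField q ℚ, inferInstance, inferInstance, inferInstance,
        CyclotomicField.isCyclotomicExtension q ℚ⟩
    obtain ⟨Z, hF, hC, hA, h⟩ := key
    obtain rfl : hA = DivisionRing.toRatAlgebra := Subsingleton.elim _ _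
    exact ⟨Z, hF, hC, h⟩
  have hZ : NumberField Z := IsCyclotomicExtension.numberField {q} ℚ Z
  have hG : IsGalois ℚ Z := IsCyclotomicExtension.isGalois {q} ℚ Z
  have hcard : Module.finrank ℚ Z = q - 1 := by
    rw [IsCyclotomicExtension.finrank (n := q) Z (Polynomial.cyclotomic.irreducible_rat hq.pos),
      Nat.totient_prime hq]
  obtain ⟨g, hg⟩ := (isCyclic_galois_of_isCyclotomicExtension Z hq).exists_generator
  rw [← hcard] at hqN
  obtain ⟨L, _, _, h1, hL, j, σ, hj, hσ, hjσ⟩ :=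
    exists_cyclic_numberField hg ((Dvd.intro_left _ rfl).trans hqN)
  obtain ⟨L₂, _, _, h1', hL', ι, τ, -, hτ, hιτ⟩ := exists_cyclic_numberField hσ (h1 ▸ hs)
  refine ⟨L, _, ‹_›, L₂, _, ‹_›, h1, h1', hL', exists_ringHom_real hg hqN j hj,
    fun p hp hpq hord => ?_, σ, τ, ι, ?_, fun l => mem_range_algebraMap_of_generator hσ, hτ, hιτ⟩
  · have := Prime.natCast_of_ringHom j (prime_natCast_of_isCyclotomicExtension Z hp hq hpq hord)
    exact ⟨this, Prime.natCast_of_ringHom ι this⟩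
  · rw [orderOf_eq_card_of_forall_mem_zpowers hσ, IsGalois.card_aut_eq_finrank, h1]

theorem exists_sq_eq_neg_natCast (F : Type*) [Field F] [NumberField F]
    (hdeg : Module.finrank ℚ F = 2) (himag : IsEmpty (F →+* ℝ)) :
    ∃ (d : ℕ) (δ : F), d ≠ 0 ∧ δ ^ 2 = -(d : F) := by
  obtain ⟨φ⟩ : Nonempty (F →+* ℂ) := inferInstance
  obtain ⟨x, hx⟩ : ∃ x, (starRingEnd ℂ) (φ x) ≠ φ x := by
    by_contra! h
    have : NumberField.ComplexEmbedding.IsReal φ := RingHom.ext h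
    exact himag.false this.embedding
  have hdep : ¬ LinearIndependent ℚ ![1, x, x ^ 2] := fun h => by
    have := h.fintype_card_le_finrank
    simp [hdeg] at this
  obtain ⟨g, hg, hg0⟩ := Fintype.not_linearIndependent_iff.1 hdep
  simp only [Fin.sum_univ_three, Rat.smul_def, Matrix.cons_val] at hg
  have hrat : ∀ (r : ℚ), φ (r : F) = (r : ℂ) := fun r => map_ratCast φ r
  have hxne : ∀ r : ℚ, x ≠ r := by
    rintro r rfl
    simp at hx
  have h2 : g 2 ≠ 0 := fun h => by
    by_cases h1 : g 1 = 0
    · have h0 : g 0 = 0 := by simpa [h, h1] using hg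
      obtain ⟨i, hi⟩ := hg0
      fin_cases i <;> simp_all
    · apply hxne (-g 0 / g 1)
      have : (g 1 : F) ≠ 0 := by exact_mod_cast h1
      push_cast
      rw [eq_div_iff this]
      rw [h] at hg
      push_cast at hg
      linear_combination hg
  have hsq : (2 * g 2 * x + g 1 : F) ^ 2 = ((g 1 ^ 2 - 4 * g 0 * g 2 : ℚ) : F) := by
    push_cast
    linear_combination 4 * (g 2 : F) * hg
  set Δ := g 1 ^ 2 - 4 * g 0 * g 2
  have hneg : Δ < 0 := by
    by_contra! hpos
    have h3 : (φ (2 * g 2 * x + g 1)) ^ 2 = ((Real.sqrt Δ : ℝ) : ℂ) ^ 2 := by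
      rw [← map_pow, hsq, hrat, ← Complex.ofReal_pow, Real.sq_sqrt (by exact_mod_cast hpos)]
      simp
    have h4 : (starRingEnd ℂ) (φ (2 * g 2 * x + g 1)) = φ (2 * g 2 * x + g 1) := by
      rcases sq_eq_sq_iff_eq_or_eq_neg.1 h3 with h | h <;> rw [h] <;> simp
    apply hx
    simp only [map_add, map_mul, hrat, map_ofNat, map_ratCast] at h4
    have h5 : (2 * g 2 : ℂ) ≠ 0 := by simpa using h2
    exact mul_left_cancel₀ h5 (add_right_cancel h4)
  refine ⟨Δ.num.natAbs * Δ.den, Δ.den * (2 * g 2 * x + g 1), ?_, ?_⟩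
  · have := Rat.num_neg.2 hneg
    exact mul_ne_zero (by lia) Δ.den_ne_zero
  · rw [mul_pow, hsq]
    have h6 : ((Δ.num.natAbs : ℕ) : ℚ) = -Δ.num := by
      have := Rat.num_neg.2 hneg
      have : ((Δ.num.natAbs : ℕ) : ℤ) = -Δ.num := by lia
      rw [← Int.cast_natCast, this]
      push_cast
      rfl
    have h7 : (Δ.den : ℚ) ^ 2 * Δ = -((Δ.num.natAbs * Δ.den : ℕ) : ℚ) := by
      push_cast
      rw [h6]
      have := Rat.mul_den_eq_num Δ
      linear_combination (Δ.den : ℚ) * this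
    have := congrArg (Rat.cast : ℚ → F) h7
    push_cast at this ⊢
    exact this

open IntermediateField Polynomial in
theorem exists_extension_pow_eq {F : Type u} [Field F] [NumberField F] {m : ℕ} (hm : m ≠ 0) (γ : F) :
    ∃ (K : Type u) (_ : Field K) (_ : NumberField K) (_ : Algebra F K) (θ : K),
      θ ^ m = algebraMap F K γ ∧ Module.finrank F K ≤ m := by
  obtain ⟨θ, hθ⟩ := IsAlgClosed.exists_pow_nat_eq (algebraMap F (AlgebraicClosure F) γ)
    (Nat.pos_of_ne_zero hm)
  have hint : IsIntegral F θ := Algebra.IsIntegral.isIntegral θ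
  have : FiniteDimensional F F⟮θ⟯ := adjoin.finiteDimensional hint
  refine ⟨F⟮θ⟯, inferInstance, NumberField.of_module_finite F _, inferInstance,
    AdjoinSimple.gen F θ, Subtype.ext hθ, ?_⟩
  rw [adjoin.finrank hint, ← natDegree_X_pow_sub_C (n := m) (r := γ)]
  exact natDegree_le_of_dvd (minpoly.dvd F θ (by simp [hθ])) (X_pow_sub_C_ne_zero (Nat.pos_of_ne_zero hm) γ)

open IntermediateField in
theorem exists_galois_compositum (K : Type u) {M : Type*} [Field K] [NumberField K] [Field M]
    [NumberField M] [IsGalois ℚ M] :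
    ∃ (E : Type u) (_ : Field E) (_ : NumberField E) (_ : Algebra K E) (ι : M →+* E),
      IsGalois K E ∧ ∀ h : Gal(E/K), (∀ x, h (ι x) = ι x) → h = 1 := by
  obtain ⟨j⟩ : Nonempty (M →ₐ[ℚ] AlgebraicClosure K) := ⟨IsAlgClosed.lift⟩
  obtain ⟨α, hα⟩ := Field.exists_primitive_element ℚ M
  have hint : IsIntegral K (j α) := Algebra.IsIntegral.isIntegral _
  have : FiniteDimensional K K⟮j α⟯ := adjoin.finiteDimensional hint
  have hmem : ∀ x, j x ∈ K⟮j α⟯ := fun x => by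
    have h1 : ℚ⟮α⟯ ≤ ((K⟮j α⟯).restrictScalars ℚ).comap j := by
      rw [adjoin_simple_le_iff]
      exact mem_adjoin_simple_self K (j α)
    rw [hα] at h1
    exact h1 mem_top
  have hnormal : Normal K K⟮j α⟯ := by
    rw [normal_iff_forall_map_le']
    intro σ
    rw [adjoin_map, Set.image_singleton, adjoin_simple_le_iff]
    obtain ⟨g, hg⟩ := exists_galois_comp_eq (j : M →+* AlgebraicClosure K)
      (σ : AlgebraicClosure K →+* AlgebraicClosure K)
    have := hg α
    change σ (j α) = j (g α) at this
    change σ (j α) ∈ _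
    rw [this]
    exact hmem _
  refine ⟨K⟮j α⟯, inferInstance, NumberField.of_module_finite K _, inferInstance,
    (j : M →+* AlgebraicClosure K).codRestrict K⟮j α⟯ hmem, ⟨⟩, fun h hh => ?_⟩
  ext x
  have : (h : K⟮j α⟯ →ₐ[K] K⟮j α⟯) = AlgHom.id K _ := by
    refine algHom_ext_of_eq_adjoin K rfl fun x hx => ?_
    obtain rfl := hx
    exact hh α
  rw [AlgEquiv.one_apply]
  exact congrArg Subtype.val (DFunLike.congr_fun this x)

/-- The automorphisms of `M` induced by those of `E` over `K` through an embedding of `M`. -/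
theorem exists_galois_restrict {K E M : Type*} [Field K] [Field E] [CharZero E] [Algebra K E]
    [Field M] [CharZero M] [Normal ℚ M] (ι : M →+* E)
    (hι : ∀ h : Gal(E/K), (∀ x, h (ι x) = ι x) → h = 1) :
    ∃ r : Gal(E/K) →* Gal(M/ℚ), Function.Injective r ∧ ∀ h x, h (ι x) = ι (r h x) := by
  choose r hr using fun h : Gal(E/K) => exists_galois_comp_eq ι (h : E →+* E)
  replace hr : ∀ h x, h (ι x) = ι (r h x) := hr
  refine ⟨MonoidHom.mk' r fun a b => ?_, ?_, hr⟩
  · ext x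
    apply ι.injective
    rw [← hr, AlgEquiv.mul_apply, AlgEquiv.mul_apply, hr b, hr a]
  · rw [injective_iff_map_eq_one]
    intro h h1
    refine hι h fun x => ?_
    change r h = 1 at h1
    rw [hr, h1, AlgEquiv.one_apply]

theorem Subgroup.mem_of_pow_card_eq_one {G : Type*} [Group G] [Finite G] [IsCyclic G]
    (H : Subgroup G) {x : G} (hx : x ^ Nat.card H = 1) : x ∈ H := by
  classical
  have := Fintype.ofFinite G
  have hsub : (H : Set G).toFinset ⊆ Finset.univ.filter fun a : G => a ^ Nat.card H = 1 := by
    intro a ha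
    have := pow_card_eq_one' (x := (⟨a, Set.mem_toFinset.1 ha⟩ : H))
    exact Finset.mem_filter.2 ⟨Finset.mem_univ _, congrArg Subtype.val this⟩
  have hle := IsCyclic.card_pow_eq_one_le (α := G) (n := Nat.card H) Nat.card_pos
  have heq := Finset.eq_of_subset_of_card_le hsub
    (hle.trans (by rw [Set.toFinset_card, ← Nat.card_eq_fintype_card]; rfl))
  have : x ∈ (H : Set G).toFinset := by
    rw [heq]
    simpa using hx
  exact Set.mem_toFinset.1 this

theorem exists_galois_generator {K E M : Type*} [Field K] [Field E] [CharZero E] [Algebra K E]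
    [FiniteDimensional K E] [IsGalois K E] [Field M] [NumberField M] [IsGalois ℚ M] (ι : M →+* E)
    (hι : ∀ h : Gal(E/K), (∀ x, h (ι x) = ι x) → h = 1) {τ : Gal(M/ℚ)}
    (hτ : ∀ y, y ∈ Subgroup.zpowers τ) :
    Module.finrank K E ∣ Module.finrank ℚ M ∧
      ∀ r c, c.Coprime (Module.finrank ℚ M) → r * Module.finrank K E = Module.finrank ℚ M * c →
        ∃ h : Gal(E/K), (∀ g, g ∈ Subgroup.zpowers h) ∧ ∀ x, h (ι x) = ι ((τ ^ r) x) := by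
  obtain ⟨φ, hφ, hφι⟩ := exists_galois_restrict ι hι
  have hc : IsCyclic Gal(M/ℚ) := ⟨τ, hτ⟩
  have hcard : Nat.card φ.range = Module.finrank K E := by
    rw [← IsGalois.card_aut_eq_finrank]
    exact (Nat.card_congr (φ.ofInjective hφ).toEquiv).symm
  have hord : orderOf τ = Module.finrank ℚ M := by
    rw [orderOf_eq_card_of_forall_mem_zpowers hτ, IsGalois.card_aut_eq_finrank]
  have hdvd : Module.finrank K E ∣ Module.finrank ℚ M := by
    rw [← hcard, ← IsGalois.card_aut_eq_finrank]
    exact Subgroup.card_subgroup_dvd_card _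
  refine ⟨hdvd, fun r c hcop hr => ?_⟩
  obtain ⟨h, hh⟩ := φ.range.mem_of_pow_card_eq_one (x := τ ^ r)
    (by rw [hcard, ← pow_mul, hr, pow_mul, ← hord, pow_orderOf_eq_one, one_pow])
  refine ⟨h, ?_, fun x => by rw [hφι, hh]⟩
  have hs0 : 0 < Module.finrank ℚ M := Module.finrank_pos
  have ho : orderOf h = Nat.card Gal(E/K) := by
    rw [← orderOf_injective φ hφ, hh, IsGalois.card_aut_eq_finrank, orderOf_pow, hord]
    obtain ⟨e, he⟩ := hdvd
    rw [he] at hr hcop hs0 ⊢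
    have hf0 := Nat.pos_of_mul_pos_right hs0
    have he0 := Nat.pos_of_mul_pos_left hs0
    have hre : r = e * c := by
      apply Nat.eq_of_mul_eq_mul_right hf0
      rw [hr]; ring
    rw [hre, mul_comm _ e, Nat.gcd_mul_left, hcop.coprime_mul_right_right.symm, mul_one,
      Nat.mul_div_cancel_left _ he0]
  have := Subgroup.eq_top_of_card_eq (Subgroup.zpowers h) (by rw [Nat.card_zpowers, ho])
  exact fun g => this ▸ Subgroup.mem_top g

theorem AlgEquiv.prod_range_pow_apply_eq_norm {K E : Type*} [Field K] [Field E] [Algebra K E]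
    [FiniteDimensional K E] [IsGalois K E] {h : Gal(E/K)} (hh : ∀ g, g ∈ Subgroup.zpowers h) (z : E) :
    ∏ i ∈ Finset.range (Module.finrank K E), (h ^ i) z = algebraMap K E (Algebra.norm K z) := by
  classical
  have hord : orderOf h = Module.finrank K E := by
    rw [orderOf_eq_card_of_forall_mem_zpowers hh, IsGalois.card_aut_eq_finrank]
  rw [Algebra.norm_eq_prod_automorphisms, ← hord]
  refine Finset.prod_bij (fun i _ => h ^ i) (fun _ _ => Finset.mem_univ _) ?_ ?_ fun _ _ => rfl
  · intro i hi j hj hij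
    exact pow_injOn_Iio_orderOf (by simpa using hi) (by simpa using hj) hij
  · intro g _
    obtain ⟨i, hi, rfl⟩ := Finset.mem_image.1
      ((isOfFinOrder_of_finite h).mem_zpowers_iff_mem_range_orderOf.1 (hh g))
    exact ⟨i, hi, rfl⟩

theorem exists_isCyclicPair_of_norm_eq {F K E M : Type*} [Field F] [NumberField F] [Field K]
    [NumberField K] [Field E] [NumberField E] [Field M] [NumberField M] [Algebra F K] [Algebra K E]
    [Algebra F E] [IsScalarTower F K E] [IsGalois K E] (ι : M →+* E) {h : Gal(E/K)}
    (hh : ∀ g, g ∈ Subgroup.zpowers h) {τ : Gal(M/ℚ)} (hτ : ∀ x, h (ι x) = ι (τ x))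
    {a : ℚ} {z : E} (hz : Algebra.norm K z = algebraMap ℚ K a) :
    ∃ (f : M →ₐ[ℚ] Module.End F E) (y : Module.End F E),
      IsCyclicPair τ (Module.finrank K E) a f y := by
  let y : Module.End F E :=
    LinearMap.mulLeft F z ∘ₗ (h.toLinearMap.restrictScalars F)
  have hy : ∀ v, y v = z * h v := fun v => rfl
  have hpow : ∀ (i : ℕ) v, (y ^ i) v = (∏ j ∈ Finset.range i, (h ^ j) z) * (h ^ i) v := by
    intro i
    induction i with
    | zero => simp
    | succ i ih =>
      intro v
      rw [pow_succ', Module.End.mul_apply, ih, hy, map_mul, map_prod, Finset.prod_range_succ',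
        pow_succ' h, AlgEquiv.mul_apply]
      simp only [pow_succ' h, AlgEquiv.mul_apply, pow_zero, AlgEquiv.one_apply]
      ring
  have hord : h ^ Module.finrank K E = 1 := by
    rw [← IsGalois.card_aut_eq_finrank]
    exact pow_card_eq_one'
  refine ⟨(Algebra.lsmul ℚ F E).comp ι.toRatAlgHom, y, ⟨fun l => ?_, ?_, ?_⟩⟩
  · ext v
    simp [hy, hτ]
    ring
  · ext v
    rw [hpow, AlgEquiv.prod_range_pow_apply_eq_norm hh, hord, hz]
    simp [Module.algebraMap_end_apply, Rat.smul_def]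
  · have hpw : ∀ (i : ℕ) x, (h ^ i) (ι x) = ι ((τ ^ i) x) := by
      intro i
      induction i with
      | zero => simp
      | succ i ih => intro x; rw [pow_succ, pow_succ, AlgEquiv.mul_apply, hτ, ih, AlgEquiv.mul_apply]
    ext x
    apply ι.injective
    rw [← hpw, hord]
    rfl

/-- For any imaginary quadratic field `F` and any `n ≥ 2`, there is a central division
algebra `D` of degree `2n` over `ℚ` which splits over `ℝ` while `D ⊗_ℚ F` is not a
division ring. -/
theorem exists_division_algebra_split_real_not_div_over_F
    (F : Type*) [Field F] [NumberField F]
    (hdeg : Module.finrank ℚ F = 2) (himag : IsEmpty (F →+* ℝ))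
    (n : ℕ) (hn : 2 ≤ n) :
    ∃ (D : Type) (_ : DivisionRing D) (_ : Algebra ℚ D),
      Module.finrank ℚ D = (2 * n) ^ 2 ∧
      Subalgebra.center ℚ D = ⊥ ∧
      Nonempty ((ℝ ⊗[ℚ] D) ≃ₐ[ℝ] Matrix (Fin (2 * n)) (Fin (2 * n)) ℝ) ∧
      ¬ ∀ x : F ⊗[ℚ] D, x ≠ 0 → IsUnit x := by
  obtain ⟨d, δ, hd, hδ⟩ := exists_sq_eq_neg_natCast F hdeg himag
  obtain ⟨j, c, hc, hjc⟩ : ∃ j c, c.Coprime (2 ^ (j + 1)) ∧ 2 * n = 2 ^ (j + 1) * c := by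
    obtain ⟨j, c, hc, rfl⟩ := Nat.exists_eq_two_pow_mul_odd (n := n) (by lia)
    exact ⟨j, c, (Nat.coprime_two_right.2 hc).pow_right _, by ring⟩
  obtain ⟨q, hq, hqN, t, hS⟩ := exists_infinite_inert_primes (N := 2 * (2 * n)) hd (by lia)
  set S := {p : ℕ | p.Prime ∧ p % 4 = 3 ∧ p ≠ q ∧ orderOf (p : ZMod q) = q - 1 ∧
    jacobiSym (-d) p = -1 ∧ jacobiSym (t ^ 2 + d) p = -1}
  obtain ⟨L, _, _, M, _, _, hL, hM, _, ⟨ρ⟩, hinert, σ, τ, ι, hσ, hfix, hτ, hιτ⟩ :=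
    exists_cyclic_tower hq hqN ⟨c, hjc⟩
  obtain ⟨K, _, _, _, θ, hθ, hFK⟩ := exists_extension_pow_eq (m := 2 ^ j) (by positivity) (t + δ : F)
  have hQK : Module.finrank ℚ K ≤ 2 ^ (j + 1) := by
    rw [← Module.finrank_mul_finrank ℚ F K, hdeg, pow_succ']
    lia
  have hK : ∀ p ∈ S, Module.finrank ℚ K = 2 ^ (j + 1) ∧
      Prime (p : NumberField.RingOfIntegers K) := by
    rintro p ⟨hp, hp4, -, -, hpd, hpt⟩
    have : Fact p.Prime := ⟨hp⟩
    refine prime_natCast_of_pow_two_pow_eq K hQK hp4 (D := -d) (t := t) (δ := algebraMap F K δ)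
      (θ := θ) ?_ ?_ ?_ ?_
    · rw [← map_pow, hδ]; simp
    · rw [hθ]; simp
    · rw [jacobiSym.legendreSym.to_jacobiSym, hpd]
    · rw [jacobiSym.legendreSym.to_jacobiSym, sub_neg_eq_add, hpt]
  obtain ⟨p₀, hp₀⟩ := hS.nonempty
  have hKM : Module.finrank ℚ K = Module.finrank ℚ M := by rw [hM, (hK p₀ hp₀).1]
  obtain ⟨E, _, _, _, κ, _, hκ⟩ := exists_galois_compositum K (M := M)
  obtain ⟨p, hp, p', hp', hne, z, hz⟩ := exists_norm_eq_div K E hS (fun h0 => Nat.not_prime_zero h0.1)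
    fun p hp => exists_relNorm_eq_span_of_prime K E M κ hκ hKM hp.1 (hK p hp).2
      (hinert p hp.1 hp.2.2.1 hp.2.2.2.1).2
  obtain ⟨hdvd, hgen⟩ := exists_galois_generator κ hκ hτ
  rw [hM] at hdvd hgen
  obtain ⟨e, he⟩ := hdvd
  obtain ⟨h, hh, hhτ⟩ := hgen (e * c) c hc (by rw [he]; ring)
  obtain ⟨v, hv, hva⟩ := exists_valuation_of_prime L (hinert p hp.1 hp.2.2.1 hp.2.2.2.1).1
    ((Nat.coprime_primes hp.1 hp'.1).2 hne)
  let _ : Algebra F E := ((algebraMap K E).comp (algebraMap F K)).toAlgebra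
  have : IsScalarTower F K E := .of_algebraMap_eq fun _ => rfl
  obtain ⟨f, y, hy⟩ := exists_isCyclicPair_of_norm_eq (F := F) κ hh hhτ hz
  have hfin : FiniteDimensional F E := Module.Finite.trans K E
  have hιpow : ∀ (i : ℕ) x, ι ((τ ^ i) x) = (σ ^ i) (ι x) := by
    intro i
    induction i with
    | zero => simp
    | succ i ih => intro x; rw [pow_succ, pow_succ, AlgEquiv.mul_apply, ih, hιτ, AlgEquiv.mul_apply]
  refine exists_divisionRing_of_isCyclicPair (r := e * c) (by lia) hL (by rw [hjc, he]; ring) hσ hfix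
    ρ.toRatAlgHom (hv σ) hva ι.toRatAlgHom (hιpow _) hy ?_
  rw [← Module.finrank_mul_finrank F K E, hM, mul_comm, pow_succ]
  have : 0 < 2 ^ j := by positivity
  exact Nat.mul_lt_mul_of_pos_left (by lia) Module.finrank_pos
end
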